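/- Fix a system of positive roots R⁺ ⊆ R with simple roots α₁,…,α_n, and for μ ∈ h* let M_μ be the Verma module of highest weight μ. For every β in the ℕ-span of the simple roots, there exists a nonzero polynomial function P on h* such that for every μ ∈ h* with P(μ) ≠ 0, the weight space M_μ[μ−β] is irreducible under the Casimir algebra C(g): its only subspaces invariant under the action of h and of all κ_α (α ∈ R) are 0 and M_μ[μ−β]. -/

import Mathlib

set_option synthInstance.maxHeartbeats 1000000
set_option maxHeartbeats 1000000

open LieAlgebra UniversalEnvelopingAlgebra

/-- `x` is a root vector for the functional `α` on the Cartan subalgebra `H`. -/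
def IsRootVector {L : Type} [LieRing L] [LieAlgebra ℂ L] (H : LieSubalgebra ℂ L)
    (α : Module.Dual ℂ H) (x : L) : Prop :=
  ∀ t : H, ⁅(t : L), x⁆ = α t • x

/-- The left ideal of `U(g)` defining the Verma module of highest weight `μ`: it is generated by
the positive root spaces and the elements `t − μ(t)·1`, `t ∈ h`. -/
noncomputable def vermaIdeal {L : Type} [LieRing L] [LieAlgebra ℂ L]
    (H : LieSubalgebra ℂ L) (Rp : Set (Module.Dual ℂ H)) (μ : Module.Dual ℂ H) :
    Ideal (UniversalEnvelopingAlgebra ℂ L) :=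
  Ideal.span
    ({x | ∃ α ∈ Rp, ∃ v : L, IsRootVector H α v ∧ x = ι ℂ v} ∪
      {x | ∃ s : H, x = ι ℂ (s : L) - algebraMap ℂ (UniversalEnvelopingAlgebra ℂ L) (μ s)})

/-- The Verma module of highest weight `μ`, as the quotient of `U(g)` by the left ideal
`vermaIdeal`. -/
abbrev VermaModule {L : Type} [LieRing L] [LieAlgebra ℂ L]
    (H : LieSubalgebra ℂ L) (Rp : Set (Module.Dual ℂ H)) (μ : Module.Dual ℂ H) :=
  UniversalEnvelopingAlgebra ℂ L ⧸
    (vermaIdeal H Rp μ : Submodule (UniversalEnvelopingAlgebra ℂ L)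
      (UniversalEnvelopingAlgebra ℂ L))

namespace TriangularDeformation

/-- Structure constants of a triangular algebra deformed by a parameter `s`: at `s = 0` it becomes
a Heisenberg algebra with `[E α, F α] = h α`. -/
structure Constants (Φ R : Type*) where
  s : R
  h : Φ → R
  k : Φ → Φ → R
  a : Φ → Φ → Φ → R
  b : Φ → Φ → Φ → R
  c : Φ → Φ → Φ → R
  g : Φ → Φ → Φ → R

/-- The structure constants vanish unless the weights `wt` add up. -/
structure Constants.IsGraded {Φ R A : Type*} [Zero R] [Add A] (C : Constants Φ R)
    (wt : Φ → A) : Prop where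
  a_supp : ∀ α γ ε, C.a α γ ε ≠ 0 → wt ε = wt α + wt γ
  b_supp : ∀ α γ ε, C.b α γ ε ≠ 0 → wt γ = wt α + wt ε
  c_supp : ∀ α γ ε, C.c α γ ε ≠ 0 → wt α = wt γ + wt ε
  g_supp : ∀ α γ ε, C.g α γ ε ≠ 0 → wt ε = wt α + wt γ

/-- A module generated by a highest weight vector over the algebra with structure
constants `C`. -/
structure System {Φ R : Type*} [Fintype Φ] [CommRing R] (C : Constants Φ R)
    (M : Type*) [AddCommGroup M] [Module R M] where
  E : Φ → Module.End R M
  F : Φ → Module.End R M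
  H : Φ → Module.End R M
  v : M
  E_v : ∀ α, E α v = 0
  H_v : ∀ α, H α v = C.h α • v
  EF_self : ∀ α, E α * F α = F α * E α + H α
  HF : ∀ α γ, H α * F γ = F γ * H α + (C.s * C.k α γ) • F γ
  EF : ∀ α γ, α ≠ γ → E α * F γ = F γ * E α +
    C.s • (∑ ε, C.b α γ ε • F ε + ∑ ε, C.c α γ ε • E ε)
  FF : ∀ α γ, F α * F γ = F γ * F α + C.s • ∑ ε, C.a α γ ε • F ε
  EE : ∀ α γ, E α * E γ = E γ * E α + C.s • ∑ ε, C.g α γ ε • E ε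

variable {Φ R A M : Type*} [Fintype Φ] [DecidableEq Φ] [CommRing R] [AddCommGroup A]
  [AddCommGroup M] [Module R M] {C : Constants Φ R}

/-- The weight of a multiset. -/
def mwt (wt : Φ → A) (m : Multiset Φ) : A := (m.map wt).sum

omit [Fintype Φ] [DecidableEq Φ] in
@[simp] lemma mwt_cons (wt : Φ → A) (α : Φ) (m : Multiset Φ) :
    mwt wt (α ::ₘ m) = wt α + mwt wt m := by simp [mwt]

omit [Fintype Φ] [DecidableEq Φ] in
@[simp] lemma mwt_zero (wt : Φ → A) : mwt wt 0 = 0 := by simp [mwt]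

omit [Fintype Φ] in
lemma mwt_erase (wt : Φ → A) {α : Φ} {m : Multiset Φ} (h : α ∈ m) :
    mwt wt (m.erase α) = mwt wt m - wt α := by
  conv_rhs => rw [← Multiset.cons_erase h]
  simp

namespace System

variable (S : System C M) (wt : Φ → A)

/-- The vector obtained by applying a word in the lowering operators. -/
def word (w : List Φ) : M := (w.map S.F).prod S.v

/-- The ordered monomial attached to a multiset. -/
noncomputable def y (m : Multiset Φ) : M := S.word m.toList

/-- The span of the monomials of weight `b`. -/
def L (b : A) : Submodule R M := Submodule.span R (S.y '' {m | mwt wt m = b})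

/-- The multiples of the deformation parameter in `L b`. -/
def J (b : A) : Submodule R M := (S.L wt b).map (LinearMap.lsmul R M C.s)

variable {wt}

omit [DecidableEq Φ] in
@[simp] lemma word_nil : S.word [] = S.v := by simp [word]

omit [DecidableEq Φ] in
lemma word_append (u w : List Φ) : S.word (u ++ w) = (u.map S.F).prod (S.word w) := by
  simp [word]

omit [DecidableEq Φ] in
lemma word_cons (x : Φ) (w : List Φ) : S.word (x :: w) = S.F x (S.word w) := by
  simp [word]

omit [DecidableEq Φ] in
lemma y_mem {b : A} {m : Multiset Φ} (h : mwt wt m = b) : S.y m ∈ S.L wt b :=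
  Submodule.subset_span ⟨m, h, rfl⟩

omit [DecidableEq Φ] in
lemma smul_mem_J {b : A} {x : M} (h : x ∈ S.L wt b) : C.s • x ∈ S.J wt b :=
  ⟨x, h, rfl⟩

omit [DecidableEq Φ] in
lemma J_le (b : A) : S.J wt b ≤ S.L wt b := by
  rintro _ ⟨x, hx, rfl⟩
  exact (S.L wt b).smul_mem _ hx

omit [DecidableEq Φ] in
lemma word_mem_aux (hC : C.IsGraded wt) (n : ℕ) : ∀ w : List Φ, w.length = n →
    S.word w ∈ S.L wt (mwt wt w) ∧ ∀ w', w.Perm w' → S.word w - S.word w' ∈ S.J wt (mwt wt w) := by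
  induction n using Nat.strong_induction_on with
  | _ n ih =>
  have key : ∀ w w' : List Φ, w.Perm w' → ∀ u : List Φ, (u ++ w).length = n →
      S.word (u ++ w) - S.word (u ++ w') ∈ S.J wt (mwt wt (u ++ w : List Φ)) := by
    intro w w' hp
    induction hp with
    | nil => intro u _; simp
    | cons x _ ihp =>
      intro u hu
      have := ihp (u ++ [x]) (by simpa using hu)
      simpa using this
    | swap x z w =>
      intro u hu
      have : S.word (u ++ z :: x :: w) - S.word (u ++ x :: z :: w) =
          C.s • ∑ ε, C.a z x ε • S.word (u ++ ε :: w) := by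
        have h := congrArg (fun T : Module.End R M => (u.map S.F).prod (T (S.word w))) (S.FF z x)
        simp only [Module.End.mul_apply, LinearMap.add_apply, LinearMap.smul_apply,
          LinearMap.sum_apply, map_add, map_smul, map_sum] at h
        simp only [word_append, word_cons, h]
        simp
      rw [this]
      refine S.smul_mem_J (Submodule.sum_mem _ fun ε _ => ?_)
      by_cases h0 : C.a z x ε = 0
      · simp [h0]
      refine Submodule.smul_mem _ _ ?_
      have hm := (ih (u ++ ε :: w).length (by rw [← hu]; simp) _ rfl).1
      have hw : mwt wt (u ++ ε :: w : List Φ) = mwt wt (u ++ z :: x :: w : List Φ) := by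
        simp [mwt, hC.a_supp _ _ _ h0, add_assoc]
      rwa [hw] at hm
    | trans h1 h2 ih1 ih2 =>
      intro u hu
      have e1 := ih1 u hu
      have e2 := ih2 u (by rw [← hu]; simp [h1.length_eq])
      have hw : mwt wt (u ++ _ : List Φ) = mwt wt (u ++ _ : List Φ) :=
        congrArg (mwt wt) (Multiset.coe_eq_coe.2 (h1.append_left u))
      rw [← hw] at e2
      simpa using add_mem e1 e2
  intro w hw
  have hJ : ∀ w', w.Perm w' → S.word w - S.word w' ∈ S.J wt (mwt wt w) := fun w' h => by
    simpa using key w w' h [] (by simpa using hw)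
  refine ⟨?_, hJ⟩
  have h1 := S.J_le _ (hJ (w : Multiset Φ).toList
    (Multiset.coe_eq_coe.1 (Multiset.coe_toList (w : Multiset Φ)).symm))
  have h2 : S.y (w : Multiset Φ) ∈ S.L wt (mwt wt w) := S.y_mem rfl
  simpa [y] using add_mem h1 h2

omit [DecidableEq Φ] in
lemma word_mem (hC : C.IsGraded wt) (w : List Φ) : S.word w ∈ S.L wt (mwt wt w) :=
  (S.word_mem_aux hC _ w rfl).1

omit [DecidableEq Φ] in
lemma word_sub_mem (hC : C.IsGraded wt) {w w' : List Φ} (h : w.Perm w') :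
    S.word w - S.word w' ∈ S.J wt (mwt wt w) :=
  (S.word_mem_aux hC _ w rfl).2 w' h

omit [DecidableEq Φ] in
lemma word_sub_y_mem (hC : C.IsGraded wt) (w : List Φ) :
    S.word w - S.y w ∈ S.J wt (mwt wt w) :=
  S.word_sub_mem hC (Multiset.coe_eq_coe.1 (Multiset.coe_toList (w : Multiset Φ)).symm)

omit [DecidableEq Φ] in
lemma H_word (α : Φ) (w : List Φ) :
    ∃ r : R, S.H α (S.word w) = (C.h α + C.s * r) • S.word w := by
  induction w with
  | nil => exact ⟨0, by simp [S.H_v]⟩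
  | cons x w ih =>
    obtain ⟨r, hr⟩ := ih
    refine ⟨r + C.k α x, ?_⟩
    have h := congrArg (fun T : Module.End R M => T (S.word w)) (S.HF α x)
    simp only [Module.End.mul_apply, LinearMap.add_apply, LinearMap.smul_apply, hr,
      map_smul] at h
    rw [word_cons, h, ← add_smul]
    congr 1
    ring

omit [DecidableEq Φ] in
lemma F_mem_L (hC : C.IsGraded wt) (α : Φ) {b : A} {x : M} (hx : x ∈ S.L wt b) :
    S.F α x ∈ S.L wt (wt α + b) := by
  induction hx using Submodule.span_induction with
  | mem x h =>
    obtain ⟨m, rfl, rfl⟩ := h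
    have := S.word_mem hC (α :: m.toList)
    rwa [word_cons, ← Multiset.cons_coe, Multiset.coe_toList, mwt_cons] at this
  | zero => simp
  | add x y _ _ hx hy => rw [map_add]; exact add_mem hx hy
  | smul r x _ hx => rw [map_smul]; exact Submodule.smul_mem _ _ hx

omit [DecidableEq Φ] in
lemma F_mem_J (hC : C.IsGraded wt) (α : Φ) {b : A} {x : M} (hx : x ∈ S.J wt b) :
    S.F α x ∈ S.J wt (wt α + b) := by
  obtain ⟨x, hx, rfl⟩ := hx
  simpa using S.smul_mem_J (S.F_mem_L hC α hx)

lemma E_word (hC : C.IsGraded wt) (w : List Φ) : ∀ α : Φ,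
    S.E α (S.word w) - ((w.count α : R) * C.h α) • S.word (w.erase α) ∈
      S.J wt (mwt wt w - wt α) := by
  induction w with
  | nil => intro α; simp [S.E_v]
  | cons x w ih =>
    have mem : ∀ α, S.E α (S.word w) ∈ S.L wt (mwt wt w - wt α) := by
      intro α
      have h1 := S.J_le _ (ih α)
      have h2 : ((w.count α : R) * C.h α) • S.word (w.erase α) ∈ S.L wt (mwt wt w - wt α) := by
        by_cases hα : α ∈ w
        · have := S.word_mem hC (w.erase α)
          rw [← Multiset.coe_erase, mwt_erase wt (by simpa using hα)] at this
          exact Submodule.smul_mem _ _ this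
        · simp [List.count_eq_zero_of_not_mem hα]
      simpa using add_mem h1 h2
    intro α
    have hFih := S.F_mem_J hC x (ih α)
    have hwt : wt x + (mwt wt w - wt α) = mwt wt (x :: w : List Φ) - wt α := by
      rw [← Multiset.cons_coe, mwt_cons]; abel
    rw [hwt, map_sub, map_smul] at hFih
    by_cases hx : α = x
    · subst hx
      obtain ⟨r, hr⟩ := S.H_word α w
      have h := congrArg (fun T : Module.End R M => T (S.word w)) (S.EF_self α)
      simp only [Module.End.mul_apply, LinearMap.add_apply, hr] at h
      have hw : mwt wt (α :: w : List Φ) - wt α = mwt wt w := by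
        rw [← Multiset.cons_coe, mwt_cons]; abel
      rw [hw] at hFih ⊢
      have h1 : ((w.count α : R) * C.h α) • (S.F α (S.word (w.erase α)) - S.word w) ∈
          S.J wt (mwt wt w) := by
        by_cases hα : α ∈ w
        · refine Submodule.smul_mem _ _ ?_
          have := S.word_sub_mem hC (List.perm_cons_erase hα)
          rw [← neg_mem_iff]
          simpa [word_cons] using this
        · simp [List.count_eq_zero_of_not_mem hα]
      have h2 : C.s • (r • S.word w) ∈ S.J wt (mwt wt w) :=
        S.smul_mem_J (Submodule.smul_mem _ _ (S.word_mem hC w))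
      convert add_mem (add_mem hFih h1) h2 using 1
      rw [word_cons, h]
      simp only [List.count_cons_self, List.erase_cons_head, Nat.cast_add, Nat.cast_one]
      module
    · have h := congrArg (fun T : Module.End R M => T (S.word w)) (S.EF α x hx)
      simp only [Module.End.mul_apply, LinearMap.add_apply, LinearMap.smul_apply,
        LinearMap.sum_apply] at h
      rw [word_cons, h]
      have hx' : x ≠ α := Ne.symm hx
      have he : (x :: w).erase α = x :: w.erase α := by
        rw [List.erase_cons_tail]; simpa using hx'
      rw [he, List.count_cons_of_ne hx', word_cons, add_sub_right_comm]
      refine add_mem hFih (S.smul_mem_J (add_mem (Submodule.sum_mem _ fun ε _ => ?_)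
        (Submodule.sum_mem _ fun ε _ => ?_)))
      · by_cases h0 : C.b α x ε = 0
        · simp [h0]
        refine Submodule.smul_mem _ _ ?_
        have := S.F_mem_L hC ε (S.word_mem hC w)
        convert this using 2
        rw [← Multiset.cons_coe, mwt_cons, hC.b_supp _ _ _ h0]; abel
      · by_cases h0 : C.c α x ε = 0
        · simp [h0]
        refine Submodule.smul_mem _ _ ?_
        convert mem ε using 2
        rw [← Multiset.cons_coe, mwt_cons, hC.c_supp _ _ _ h0]; abel

variable (wt) in
/-- Evaluation of formal combinations of multisets at the monomials. -/
noncomputable def Y : (Multiset Φ →₀ R) →ₗ[R] M := Finsupp.linearCombination R S.y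

variable (wt) in
/-- `T` shifts weights by `θ` and acts modulo the deformation parameter as `τ`. -/
def HasSymbol (T : Module.End R M) (τ : Module.End R (Multiset Φ →₀ R)) (θ : A) : Prop :=
  ∀ m, τ (Finsupp.single m 1) ∈ Finsupp.supported R R {m' | mwt wt m' = mwt wt m + θ} ∧
    T (S.y m) - S.Y (τ (Finsupp.single m 1)) ∈ S.J wt (mwt wt m + θ)

omit [DecidableEq Φ] in
lemma Y_mem {b : A} {x : Multiset Φ →₀ R} (hx : x ∈ Finsupp.supported R R {m | mwt wt m = b}) :
    S.Y x ∈ S.L wt b := by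
  rw [L, Finsupp.span_image_eq_map_linearCombination]
  exact ⟨x, hx, rfl⟩

variable {S}

omit [DecidableEq Φ] in
lemma HasSymbol.apply {T : Module.End R M} {τ : Module.End R (Multiset Φ →₀ R)} {θ : A}
    (h : S.HasSymbol wt T τ θ) {b : A} {x : Multiset Φ →₀ R}
    (hx : x ∈ Finsupp.supported R R {m | mwt wt m = b}) :
    τ x ∈ Finsupp.supported R R {m | mwt wt m = b + θ} ∧
      T (S.Y x) - S.Y (τ x) ∈ S.J wt (b + θ) := by
  rw [Finsupp.supported_eq_span_single] at hx
  induction hx using Submodule.span_induction with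
  | mem x h' =>
    obtain ⟨m, rfl, rfl⟩ := h'
    simpa [Y] using h m
  | zero => simp
  | add x y _ _ hx hy =>
    refine ⟨by rw [map_add]; exact add_mem hx.1 hy.1, ?_⟩
    convert add_mem hx.2 hy.2 using 1
    simp only [map_add]; abel
  | smul r x _ hx =>
    refine ⟨by rw [map_smul]; exact Submodule.smul_mem _ _ hx.1, ?_⟩
    convert Submodule.smul_mem _ r hx.2 using 1
    simp only [map_smul, smul_sub]

omit [DecidableEq Φ] in
lemma HasSymbol.map_L {T : Module.End R M} {τ : Module.End R (Multiset Φ →₀ R)} {θ : A}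
    (h : S.HasSymbol wt T τ θ) {b : A} {x : M} (hx : x ∈ S.L wt b) : T x ∈ S.L wt (b + θ) := by
  rw [L, Finsupp.span_image_eq_map_linearCombination] at hx
  obtain ⟨x, hx, rfl⟩ := hx
  have := h.apply hx
  have h' := add_mem (S.J_le _ this.2) (S.Y_mem this.1)
  rwa [sub_add_cancel] at h'

omit [DecidableEq Φ] in
lemma HasSymbol.mul {T T' : Module.End R M} {τ τ' : Module.End R (Multiset Φ →₀ R)} {θ θ' : A}
    (h : S.HasSymbol wt T τ θ) (h' : S.HasSymbol wt T' τ' θ') :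
    S.HasSymbol wt (T * T') (τ * τ') (θ' + θ) := by
  intro m
  obtain ⟨h1, h2⟩ := h' m
  obtain ⟨h3, h4⟩ := h.apply h1
  rw [← add_assoc]
  refine ⟨h3, ?_⟩
  obtain ⟨z, hz, hz'⟩ := h2
  have h5 : T (T' (S.y m) - S.Y (τ' (Finsupp.single m 1))) ∈ S.J wt (mwt wt m + θ' + θ) := by
    rw [← hz']
    simpa using S.smul_mem_J (h.map_L hz)
  convert add_mem h5 h4 using 1
  simp

omit [DecidableEq Φ] in
lemma HasSymbol.add {T T' : Module.End R M} {τ τ' : Module.End R (Multiset Φ →₀ R)} {θ : A}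
    (h : S.HasSymbol wt T τ θ) (h' : S.HasSymbol wt T' τ' θ) :
    S.HasSymbol wt (T + T') (τ + τ') θ := by
  intro m
  refine ⟨add_mem (h m).1 (h' m).1, ?_⟩
  convert add_mem (h m).2 (h' m).2 using 1
  simp only [LinearMap.add_apply, map_add]; abel

omit [DecidableEq Φ] in
lemma HasSymbol.smul {T : Module.End R M} {τ : Module.End R (Multiset Φ →₀ R)} {θ θ' : A}
    (r : R) (hr : r ≠ 0 → θ' = θ) (h : S.HasSymbol wt T τ θ) :
    S.HasSymbol wt (r • T) (r • τ) θ' := by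
  intro m
  by_cases h0 : r = 0
  · simp [h0]
  rw [hr h0]
  refine ⟨Submodule.smul_mem _ r (h m).1, ?_⟩
  convert Submodule.smul_mem _ r (h m).2 using 1
  simp only [LinearMap.smul_apply, map_smul, smul_sub]

omit [DecidableEq Φ] in
lemma HasSymbol.sum {ι : Type*} (s : Finset ι) {T : ι → Module.End R M}
    {τ : ι → Module.End R (Multiset Φ →₀ R)} {θ : A}
    (h : ∀ i ∈ s, S.HasSymbol wt (T i) (τ i) θ) :
    S.HasSymbol wt (∑ i ∈ s, T i) (∑ i ∈ s, τ i) θ := by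
  intro m
  simp only [LinearMap.sum_apply, map_sum, ← Finset.sum_sub_distrib]
  exact ⟨Submodule.sum_mem _ fun i hi => (h i hi m).1, Submodule.sum_mem _ fun i hi => (h i hi m).2⟩

variable (R) in
/-- The symbol of a lowering operator: multiplication. -/
noncomputable def fOp (α : Φ) : Module.End R (Multiset Φ →₀ R) :=
  Finsupp.lmapDomain R R (Multiset.cons α)

variable (C) in
/-- The symbol of a raising operator: a derivation. -/
noncomputable def eOp (α : Φ) : Module.End R (Multiset Φ →₀ R) :=
  Finsupp.linearCombination R fun m => Finsupp.single (m.erase α) ((m.count α : R) * C.h α)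

omit [Fintype Φ] [DecidableEq Φ] in
@[simp] lemma fOp_single (α : Φ) (m : Multiset Φ) (r : R) :
    fOp R α (Finsupp.single m r) = Finsupp.single (α ::ₘ m) r := by
  simp [fOp]

omit [Fintype Φ] in
@[simp] lemma eOp_single (α : Φ) (m : Multiset Φ) (r : R) :
    eOp C α (Finsupp.single m r) =
      Finsupp.single (m.erase α) (r * ((m.count α : R) * C.h α)) := by
  simp only [eOp, Finsupp.linearCombination_single, Finsupp.smul_single, smul_eq_mul]

omit [DecidableEq Φ] in
lemma hasSymbol_F (hC : C.IsGraded wt) (α : Φ) :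
    S.HasSymbol wt (S.F α) (fOp R α) (wt α) := by
  intro m
  refine ⟨?_, ?_⟩
  · rw [fOp_single]
    exact Finsupp.single_mem_supported R 1 (by simp [add_comm])
  · have := S.word_sub_y_mem hC (α :: m.toList)
    rw [← Multiset.cons_coe, Multiset.coe_toList, mwt_cons, add_comm] at this
    simpa [Y, y, word_cons] using this

lemma hasSymbol_E (hC : C.IsGraded wt) (α : Φ) :
    S.HasSymbol wt (S.E α) (eOp C α) (-wt α) := by
  intro m
  rw [← sub_eq_add_neg, eOp_single]
  by_cases hα : α ∈ m
  · refine ⟨Finsupp.single_mem_supported R _ (mwt_erase wt hα), ?_⟩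
    have h1 := S.E_word hC m.toList α
    rw [Multiset.coe_toList] at h1
    have h2 := S.word_sub_y_mem hC (m.toList.erase α)
    rw [← Multiset.coe_erase, Multiset.coe_toList, mwt_erase wt hα] at h2
    have hc : m.toList.count α = m.count α := by
      rw [← Multiset.coe_count, Multiset.coe_toList]
    convert add_mem h1 (Submodule.smul_mem _ ((m.count α : R) * C.h α) h2) using 1
    simp only [Y, Finsupp.linearCombination_single, hc, y]
    module
  · have h1 := S.E_word hC m.toList α
    rw [Multiset.coe_toList] at h1
    have hc : m.toList.count α = 0 := by
      rw [← Multiset.coe_count, Multiset.coe_toList, Multiset.count_eq_zero_of_notMem hα]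
    rw [hc] at h1
    simpa [Multiset.count_eq_zero_of_notMem hα, y] using h1

omit [DecidableEq Φ] in
lemma mem_L_iff {β : A} [Fintype {m : Multiset Φ // mwt wt m = β}] {x : M} :
    x ∈ S.L wt β ↔ ∃ r : {m : Multiset Φ // mwt wt m = β} → R, ∑ i, r i • S.y i = x := by
  have : S.y '' {m | mwt wt m = β} =
      Set.range fun i : {m : Multiset Φ // mwt wt m = β} => S.y i := by
    ext z; simp
  rw [L, this, Submodule.mem_span_range_iff_exists_fun]

omit [DecidableEq Φ] in
/-- An operator with a symbol is represented on monomials by a matrix which reduces to the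
symbol. -/
lemma HasSymbol.exists_matrix {k : Type*} [CommRing k] (χ : R →+* k) (hχ : χ C.s = 0)
    {T : Module.End R M} {τ : Module.End R (Multiset Φ →₀ R)}
    (h : S.HasSymbol wt T τ 0) (β : A) [Fintype {m : Multiset Φ // mwt wt m = β}] :
    ∃ G : Matrix {m : Multiset Φ // mwt wt m = β} {m : Multiset Φ // mwt wt m = β} R,
      (∀ j : {m : Multiset Φ // mwt wt m = β}, T (S.y j) = ∑ i, G i j • S.y i) ∧
      ∀ i j, χ (G i j) = χ (τ (Finsupp.single j.1 1) i.1) := by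
  have key : ∀ j : {m : Multiset Φ // mwt wt m = β},
      ∃ r : {m : Multiset Φ // mwt wt m = β} → R,
        T (S.y j) = ∑ i, (τ (Finsupp.single j.1 1) i.1 + C.s * r i) • S.y i := by
    intro j
    obtain ⟨h1, z, hz, hz'⟩ := h j.1
    rw [add_zero, j.2] at hz h1
    obtain ⟨r, rfl⟩ := mem_L_iff.1 hz
    refine ⟨r, ?_⟩
    have hY : S.Y (τ (Finsupp.single j.1 1)) =
        ∑ i : {m : Multiset Φ // mwt wt m = β}, τ (Finsupp.single j.1 1) i.1 • S.y i := by
      have hinj := Subtype.val_injective (p := fun m => mwt wt m = β)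
      have hm := Finset.sum_map Finset.univ ⟨_, hinj⟩
        fun m => τ (Finsupp.single j.1 1) m • S.y m
      simp only [Function.Embedding.coeFn_mk] at hm
      rw [Y, Finsupp.linearCombination_apply, Finsupp.sum, ← hm]
      refine Finset.sum_subset (fun m hm => ?_) fun m _ hm => ?_
      · simpa using h1 hm
      · rw [Finsupp.notMem_support_iff.1 hm, zero_smul]
    rw [eq_comm, sub_eq_iff_eq_add, hY] at hz'
    rw [hz']
    simp only [LinearMap.lsmul_apply, Finset.smul_sum, ← Finset.sum_add_distrib]
    exact Finset.sum_congr rfl fun i _ => by module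
  choose r hr using key
  refine ⟨Matrix.of fun i j => τ (Finsupp.single j.1 1) i.1 + C.s * r j i, hr, fun i j => ?_⟩
  simp [hχ]

omit [Fintype Φ] [DecidableEq Φ] [CommRing R] [AddCommGroup A] in
lemma commutator_mul {𝒜 : Type*} [Ring 𝒜] {e f e' f' x w a g : 𝒜} (h1 : e * f' = f' * e + x)
    (h2 : e' * f = f * e' + w) (h3 : f * f' = f' * f + a) (h4 : e * e' = e' * e + g) :
    f * e * (f' * e') - f' * e' * (f * e) =
      f * (x * e') + f * (f' * g) + a * (e' * e) - f' * (w * e) := by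
  have e1 : f * e * (f' * e') = f * (e * f') * e' := by noncomm_ring
  have e2 : f' * e' * (f * e) = f' * (e' * f) * e := by noncomm_ring
  have e3 : f * (f' * e) * e' = f * f' * (e * e') := by noncomm_ring
  have e4 : f * f' * (e' * e) = f' * f * (e' * e) + a * (e' * e) := by rw [h3]; noncomm_ring
  rw [e1, e2, h1, h2, mul_add, add_mul, e3, h4, mul_add, e4]
  noncomm_ring

variable (S) in
/-- The leading term of the commutator of `F α * E α` and `F γ * E γ`. -/
noncomputable def bracketOp (α γ : Φ) : Module.End R M :=
  ∑ ε, (C.c α γ ε • (S.F α * (S.E ε * S.E γ)) + C.g α γ ε • (S.F α * (S.F γ * S.E ε)) +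
    C.a α γ ε • (S.F ε * (S.E γ * S.E α)) + (-C.b γ α ε) • (S.F γ * (S.F ε * S.E α)))

variable (C) in
/-- The symbol of `bracketOp`. -/
noncomputable def bracketSymbol (α γ : Φ) : Module.End R (Multiset Φ →₀ R) :=
  ∑ ε, (C.c α γ ε • (fOp R α * (eOp C ε * eOp C γ)) +
    C.g α γ ε • (fOp R α * (fOp R γ * eOp C ε)) +
    C.a α γ ε • (fOp R ε * (eOp C γ * eOp C α)) +
    (-C.b γ α ε) • (fOp R γ * (fOp R ε * eOp C α)))

omit [DecidableEq Φ] in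
lemma commutator_eq {α γ : Φ} (h : α ≠ γ) (hb : ∀ ε, C.b α γ ε = 0) (hc : ∀ ε, C.c γ α ε = 0) :
    S.F α * S.E α * (S.F γ * S.E γ) - S.F γ * S.E γ * (S.F α * S.E α) =
      C.s • S.bracketOp α γ := by
  have h1 := S.EF α γ h
  have h2 := S.EF γ α h.symm
  simp only [hb, hc, zero_smul, Finset.sum_const_zero, zero_add, add_zero] at h1 h2
  rw [commutator_mul h1 h2 (S.FF α γ) (S.EE α γ), bracketOp]
  simp only [Finset.mul_sum, Finset.sum_mul, smul_mul_assoc, mul_smul_comm,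
    Finset.sum_add_distrib, neg_smul, Finset.sum_neg_distrib, smul_add, smul_neg, sub_eq_add_neg]

lemma hasSymbol_mul_self (hC : C.IsGraded wt) (α : Φ) :
    S.HasSymbol wt (S.F α * S.E α) (fOp R α * eOp C α) 0 := by
  simpa using (hasSymbol_F hC α).mul (hasSymbol_E (S := S) hC α)

lemma hasSymbol_bracketOp (hC : C.IsGraded wt) (α γ : Φ) :
    S.HasSymbol wt (S.bracketOp α γ) (bracketSymbol C α γ) 0 := by
  refine HasSymbol.sum _ fun ε _ => HasSymbol.add (HasSymbol.add (HasSymbol.add ?_ ?_) ?_) ?_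
  · refine HasSymbol.smul _ (fun h0 => ?_) ((hasSymbol_F hC α).mul
      ((hasSymbol_E hC ε).mul (hasSymbol_E hC γ)))
    rw [hC.c_supp _ _ _ h0]; abel
  · refine HasSymbol.smul _ (fun h0 => ?_) ((hasSymbol_F hC α).mul
      ((hasSymbol_F hC γ).mul (hasSymbol_E hC ε)))
    rw [hC.g_supp _ _ _ h0]; abel
  · refine HasSymbol.smul _ (fun h0 => ?_) ((hasSymbol_F hC ε).mul
      ((hasSymbol_E hC γ).mul (hasSymbol_E hC α)))
    rw [hC.a_supp _ _ _ h0]; abel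
  · refine HasSymbol.smul _ (fun h0 => ?_) ((hasSymbol_F hC γ).mul
      ((hasSymbol_F hC ε).mul (hasSymbol_E hC α)))
    rw [hC.b_supp _ _ _ (neg_ne_zero.1 h0)]; abel

omit [Fintype Φ] in
lemma mul_self_symbol_apply (α : Φ) (m m' : Multiset Φ) :
    (fOp R α * eOp C α) (Finsupp.single m 1) m' =
      if m = m' then (m.count α : R) * C.h α else 0 := by
  rw [Module.End.mul_apply, eOp_single, fOp_single, Finsupp.single_apply, one_mul]
  by_cases hα : α ∈ m
  · rw [Multiset.cons_erase hα]
  · simp [Multiset.count_eq_zero_of_notMem hα]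

lemma bracketSymbol_apply (α γ : Φ) (m m' : Multiset Φ) :
    bracketSymbol C α γ (Finsupp.single m 1) m' = ∑ ε,
      (C.c α γ ε * (if α ::ₘ (m.erase γ).erase ε = m' then
          m.count γ * C.h γ * ((m.erase γ).count ε * C.h ε) else 0) +
        C.g α γ ε * (if α ::ₘ γ ::ₘ m.erase ε = m' then m.count ε * C.h ε else 0) +
        C.a α γ ε * (if ε ::ₘ (m.erase α).erase γ = m' then
          m.count α * C.h α * ((m.erase α).count γ * C.h γ) else 0) +
        -C.b γ α ε * (if γ ::ₘ ε ::ₘ m.erase α = m' then m.count α * C.h α else 0)) := by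
  simp only [bracketSymbol, LinearMap.sum_apply, LinearMap.add_apply, LinearMap.smul_apply,
    Module.End.mul_apply, eOp_single, fOp_single, Finsupp.coe_finsetSum, Finset.sum_apply,
    Finsupp.add_apply, Finsupp.smul_apply, smul_eq_mul, Finsupp.single_apply, one_mul]

/-- The matrix entry of the bracket symbol merging `γ` and `δ` into `α`. -/
lemma bracketSymbol_merge (hC : C.IsGraded wt) {α γ δ : Φ} (hγ : γ ≠ α) (hδ : δ ≠ α)
    (hne : ∀ γ, wt γ ≠ 0) (m : Multiset Φ) :
    bracketSymbol C α γ (Finsupp.single (γ ::ₘ δ ::ₘ m) 1) (α ::ₘ m) =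
      C.c α γ δ * (((γ ::ₘ δ ::ₘ m).count γ : R) * C.h γ *
        (((δ ::ₘ m).count δ : R) * C.h δ)) := by
  have h1 : ∀ ε, (if α ::ₘ ((γ ::ₘ δ ::ₘ m).erase γ).erase ε = α ::ₘ m then
      ((γ ::ₘ δ ::ₘ m).count γ : R) * C.h γ *
        (((γ ::ₘ δ ::ₘ m).erase γ).count ε * C.h ε) else 0) =
      if ε = δ then ((γ ::ₘ δ ::ₘ m).count γ : R) * C.h γ *
        ((δ ::ₘ m).count δ * C.h δ) else 0 := by
    intro ε
    rw [Multiset.erase_cons_head]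
    by_cases hε : ε = δ
    · subst hε; simp
    · rw [if_neg hε]
      by_cases hm : ε ∈ δ ::ₘ m
      · rw [if_neg]
        rw [Multiset.cons_inj_right]
        intro h
        have := congrArg (Multiset.cons ε) h
        rw [Multiset.cons_erase hm] at this
        exact hε ((Multiset.cons_inj_left _).1 this).symm
      · simp [Multiset.count_eq_zero_of_notMem hm]
  have h2 : ∀ ε, (if α ::ₘ γ ::ₘ (γ ::ₘ δ ::ₘ m).erase ε = α ::ₘ m then
      ((γ ::ₘ δ ::ₘ m).count ε : R) * C.h ε else 0) = 0 := by
    intro ε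
    refine ite_eq_right_iff.2 fun h => ?_
    by_cases hm : ε ∈ γ ::ₘ δ ::ₘ m
    · have h' := congrArg Multiset.card h
      have := Multiset.card_erase_add_one hm
      simp only [Multiset.card_cons] at h' this
      omega
    · simp [Multiset.count_eq_zero_of_notMem hm]
  have h3 : ∀ ε, C.a α γ ε * (if ε ::ₘ ((γ ::ₘ δ ::ₘ m).erase α).erase γ = α ::ₘ m then
      ((γ ::ₘ δ ::ₘ m).count α : R) * C.h α *
        (((γ ::ₘ δ ::ₘ m).erase α).count γ * C.h γ) else 0) = 0 := by
    intro ε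
    by_cases h0 : C.a α γ ε = 0
    · simp [h0]
    have hε : α ≠ ε := by
      rintro rfl
      exact hne γ (by simpa using hC.a_supp _ _ _ h0)
    rw [if_neg, mul_zero]
    intro h
    have h' := congrArg (Multiset.count α) h
    rw [Multiset.count_cons_of_ne hε, Multiset.count_cons_self] at h'
    have h4 := (Multiset.count_le_of_le α (Multiset.erase_le γ ((γ ::ₘ δ ::ₘ m).erase α))).trans
      (Multiset.count_le_of_le α (Multiset.erase_le α (γ ::ₘ δ ::ₘ m)))
    rw [Multiset.count_cons_of_ne hγ.symm, Multiset.count_cons_of_ne hδ.symm] at h4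
    omega
  have h4 : ∀ ε, (if γ ::ₘ ε ::ₘ (γ ::ₘ δ ::ₘ m).erase α = α ::ₘ m then
      ((γ ::ₘ δ ::ₘ m).count α : R) * C.h α else 0) = 0 := by
    intro ε
    refine ite_eq_right_iff.2 fun h => ?_
    by_cases hm : α ∈ γ ::ₘ δ ::ₘ m
    · have h' := congrArg Multiset.card h
      have := Multiset.card_erase_add_one hm
      simp only [Multiset.card_cons] at h' this
      omega
    · simp [Multiset.count_eq_zero_of_notMem hm]
  rw [bracketSymbol_apply]
  simp only [h1, h2, h3, h4, mul_zero, add_zero, mul_ite, Finset.sum_ite_eq', Finset.mem_univ,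
    if_true]

/-- The matrix entry of the bracket symbol splitting `α` into `γ` and `δ`. -/
lemma bracketSymbol_split (hC : C.IsGraded wt) {α γ δ : Φ} (hγ : γ ≠ α) (hδ : δ ≠ α)
    (hne : ∀ γ, wt γ ≠ 0) (m : Multiset Φ) :
    bracketSymbol C α γ (Finsupp.single (α ::ₘ m) 1) (γ ::ₘ δ ::ₘ m) =
      -C.b γ α δ * (((α ::ₘ m).count α : R) * C.h α) := by
  have h1 : ∀ ε, (if α ::ₘ ((α ::ₘ m).erase γ).erase ε = γ ::ₘ δ ::ₘ m then
      ((α ::ₘ m).count γ : R) * C.h γ *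
        (((α ::ₘ m).erase γ).count ε * C.h ε) else 0) = 0 := by
    intro ε
    refine ite_eq_right_iff.2 fun h => ?_
    by_cases hm : γ ∈ α ::ₘ m
    · by_cases hm' : ε ∈ (α ::ₘ m).erase γ
      · have h' := congrArg Multiset.card h
        have := Multiset.card_erase_add_one hm
        have := Multiset.card_erase_add_one hm'
        simp only [Multiset.card_cons] at *
        omega
      · simp [Multiset.count_eq_zero_of_notMem hm']
    · simp [Multiset.count_eq_zero_of_notMem hm]
  have h2 : ∀ ε, C.g α γ ε * (if α ::ₘ γ ::ₘ (α ::ₘ m).erase ε = γ ::ₘ δ ::ₘ m then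
      ((α ::ₘ m).count ε : R) * C.h ε else 0) = 0 := by
    intro ε
    by_cases h0 : C.g α γ ε = 0
    · simp [h0]
    have hε : α ≠ ε := by
      rintro rfl
      exact hne γ (by simpa using hC.g_supp _ _ _ h0)
    rw [if_neg, mul_zero]
    intro h
    have h' := congrArg (Multiset.count α) h
    rw [Multiset.count_cons_self, Multiset.count_cons_of_ne hγ.symm,
      Multiset.count_cons_of_ne hγ.symm, Multiset.count_cons_of_ne hδ.symm,
      Multiset.count_erase_of_ne hε, Multiset.count_cons_self] at h'
    omega
  have h3 : ∀ ε, (if ε ::ₘ ((α ::ₘ m).erase α).erase γ = γ ::ₘ δ ::ₘ m then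
      ((α ::ₘ m).count α : R) * C.h α *
        (((α ::ₘ m).erase α).count γ * C.h γ) else 0) = 0 := by
    intro ε
    refine ite_eq_right_iff.2 fun h => ?_
    rw [Multiset.erase_cons_head] at h ⊢
    by_cases hm : γ ∈ m
    · have h' := congrArg Multiset.card h
      have := Multiset.card_erase_add_one hm
      simp only [Multiset.card_cons] at h' this
      omega
    · simp [Multiset.count_eq_zero_of_notMem hm]
  have h4 : ∀ ε, (if γ ::ₘ ε ::ₘ (α ::ₘ m).erase α = γ ::ₘ δ ::ₘ m then
      ((α ::ₘ m).count α : R) * C.h α else 0) =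
      if ε = δ then ((α ::ₘ m).count α : R) * C.h α else 0 := by
    intro ε
    rw [Multiset.erase_cons_head]
    simp only [Multiset.cons_inj_right, Multiset.cons_inj_left]
  rw [bracketSymbol_apply]
  simp only [h1, h2, h3, h4, mul_zero, add_zero, zero_add, mul_ite, Finset.sum_ite_eq',
    Finset.mem_univ, if_true]

section Matrix

variable {I k : Type*} [Fintype I] [DecidableEq I] [Field k]

omit [Fintype Φ] [DecidableEq Φ] [CommRing R] [AddCommGroup A] in
/-- A matrix algebra with enough diagonal matrices and enough nonzero entries is everything. -/
lemma subalgebra_eq_top (𝒜 : Subalgebra k (Matrix I I k))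
    (hsep : ∀ i j, i ≠ j → ∃ d : I → k, Matrix.diagonal d ∈ 𝒜 ∧ d i ≠ d j)
    (hconn : ∀ i j, Relation.EqvGen
      (fun i j => (∃ W ∈ 𝒜, W i j ≠ 0) ∧ ∃ W ∈ 𝒜, W j i ≠ 0) i j) : 𝒜 = ⊤ := by
  have hdiag : ∀ i, Matrix.single i i (1 : k) ∈ 𝒜 := by
    intro i
    have h : ∀ j, ∃ d : I → k, Matrix.diagonal d ∈ 𝒜 ∧ d i = 1 ∧ (j ≠ i → d j = 0) := by
      intro j
      by_cases hj : j = i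
      · refine ⟨1, ?_, rfl, fun h => (h hj).elim⟩
        rw [Matrix.diagonal_one']
        exact one_mem 𝒜
      obtain ⟨d, hd, hne⟩ := hsep i j (Ne.symm hj)
      refine ⟨fun l => (d i - d j)⁻¹ * (d l - d j), ?_, inv_mul_cancel₀ (sub_ne_zero.2 hne),
        fun _ => by simp⟩
      have := 𝒜.smul_mem (sub_mem hd (𝒜.algebraMap_mem (d j))) (d i - d j)⁻¹
      convert this using 1
      ext a b
      by_cases hab : a = b
      · subst hab; simp [Matrix.algebraMap_matrix_apply]
      · simp [Matrix.algebraMap_matrix_apply, hab]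
    choose d hd hd1 hd0 using h
    have hp : ∀ s : Finset I, Matrix.diagonal (∏ j ∈ s, d j) ∈ 𝒜 := by
      intro s
      induction s using Finset.induction_on with
      | empty => simp
      | insert j s hj ih =>
        rw [Finset.prod_insert hj]
        have := mul_mem (hd j) ih
        rwa [Matrix.diagonal_mul_diagonal'] at this
    convert hp Finset.univ using 1
    rw [← Matrix.diagonal_single]
    congr 1
    ext l
    rw [Finset.prod_apply]
    by_cases hl : l = i
    · subst hl; simp [hd1]
    · rw [Pi.single_eq_of_ne hl, eq_comm]
      exact Finset.prod_eq_zero (Finset.mem_univ l) (hd0 l hl)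
  have hstep : ∀ i j, (∃ W ∈ 𝒜, W i j ≠ 0) → Matrix.single i j (1 : k) ∈ 𝒜 := by
    rintro i j ⟨W, hW, hne⟩
    have := 𝒜.smul_mem (mul_mem (mul_mem (hdiag i) hW) (hdiag j)) (W i j)⁻¹
    rwa [Matrix.single_mul_mul_single, Matrix.smul_single, one_mul, mul_one, smul_eq_mul,
      inv_mul_cancel₀ hne] at this
  have hall : ∀ i j, Matrix.single i j (1 : k) ∈ 𝒜 ∧ Matrix.single j i (1 : k) ∈ 𝒜 := by
    intro i j
    induction hconn i j with
    | rel i j h => exact ⟨hstep i j h.1, hstep j i h.2⟩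
    | refl i => exact ⟨hdiag i, hdiag i⟩
    | symm i j _ ih => exact ih.symm
    | trans i j l _ _ h1 h2 =>
      refine ⟨?_, ?_⟩
      · simpa using mul_mem h1.1 h2.1
      · simpa using mul_mem h2.2 h1.2
  refine eq_top_iff.2 fun W _ => ?_
  rw [Matrix.matrix_eq_sum_single W]
  refine sum_mem fun i _ => sum_mem fun j _ => ?_
  simpa using 𝒜.smul_mem (hall i j).1 (W i j)

/-- The reduction of a matrix algebra modulo a prime. -/
def reduction (χ : R →+* k) (hχ : Function.Surjective χ) (𝒵 : Subalgebra R (Matrix I I R)) :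
    Subalgebra k (Matrix I I k) :=
  { 𝒵.toSubsemiring.map χ.mapMatrix with
    algebraMap_mem' := fun r => by
      obtain ⟨r, rfl⟩ := hχ r
      refine ⟨algebraMap R _ r, 𝒵.algebraMap_mem r, ?_⟩
      ext a b
      by_cases hab : a = b
      · subst hab; simp [Matrix.algebraMap_matrix_apply]
      · simp [Matrix.algebraMap_matrix_apply, hab] }

omit [Fintype Φ] [DecidableEq Φ] [AddCommGroup A] in
lemma mem_reduction {χ : R →+* k} {hχ : Function.Surjective χ}
    {𝒵 : Subalgebra R (Matrix I I R)} {W : Matrix I I k} :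
    W ∈ reduction χ hχ 𝒵 ↔ ∃ G ∈ 𝒵, G.map χ = W := Iff.rfl

omit [Fintype Φ] [DecidableEq Φ] [AddCommGroup A] in
/-- A matrix algebra whose reduction is everything contains a multiple of each elementary
matrix. -/
lemma exists_smul_single_mem {χ : R →+* k} {hχ : Function.Surjective χ}
    {𝒵 : Subalgebra R (Matrix I I R)} (h : reduction χ hχ 𝒵 = ⊤) :
    ∃ Q : R, χ Q ≠ 0 ∧ ∀ i j, Q • Matrix.single i j (1 : R) ∈ 𝒵 := by
  have hG : ∀ p : I × I, ∃ G ∈ 𝒵, G.map χ = Matrix.single p.1 p.2 1 := fun p =>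
    mem_reduction.1 (h ▸ Algebra.mem_top)
  choose G hG hGχ using hG
  let B : Matrix (I × I) (I × I) R := Matrix.of fun p q => G p q.1 q.2
  have hB : B.map χ = 1 := by
    ext p q
    have := congrFun (congrFun (hGχ p) q.1) q.2
    rw [Matrix.map_apply] at this
    simp only [B, Matrix.map_apply, Matrix.of_apply, this, Matrix.single_apply, Matrix.one_apply,
      Prod.ext_iff]
  refine ⟨B.det, ?_, fun i j => ?_⟩
  · rw [RingHom.map_det, RingHom.mapMatrix_apply, hB, Matrix.det_one]
    exact one_ne_zero
  · have : B.det • Matrix.single i j (1 : R) = ∑ p, B.adjugate (i, j) p • G p := by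
      ext a b
      have := congrFun (congrFun B.adjugate_mul (i, j)) (a, b)
      rw [Matrix.mul_apply] at this
      simp only [Matrix.smul_apply, Matrix.sum_apply, smul_eq_mul]
      refine Eq.trans ?_ this.symm
      simp [Matrix.single_apply, Matrix.one_apply]
    rw [this]
    exact sum_mem fun p _ => 𝒵.smul_mem (hG p) _

end Matrix

/-- A submodule is Casimir stable if it is stable under the operators `F α * E α` and saturated
with respect to the deformation parameter. -/
def IsCasimirStable (S : System C M) (N : Submodule R M) : Prop :=
  (∀ α, ∀ x ∈ N, S.F α (S.E α x) ∈ N) ∧ ∀ x, C.s • x ∈ N → x ∈ N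

variable (S wt) in
/-- Matrices representing operators which preserve all Casimir stable submodules. -/
def stabilizer (β : A) [Fintype {m : Multiset Φ // mwt wt m = β}] :
    Subalgebra R (Matrix {m : Multiset Φ // mwt wt m = β} {m : Multiset Φ // mwt wt m = β} R) where
  carrier := {G | ∀ N, S.IsCasimirStable N → ∀ x : {m : Multiset Φ // mwt wt m = β} → R,
    ∑ i, x i • S.y i ∈ N → ∑ i, (G.mulVec x) i • S.y i ∈ N}
  mul_mem' := fun {G G'} hG hG' N hN x hx => by
    have := hG N hN _ (hG' N hN x hx)
    rwa [Matrix.mulVec_mulVec] at this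
  add_mem' := fun {G G'} hG hG' N hN x hx => by
    have := add_mem (hG N hN x hx) (hG' N hN x hx)
    rw [← Finset.sum_add_distrib] at this
    simpa only [Matrix.add_mulVec, Pi.add_apply, add_smul] using this
  algebraMap_mem' := fun r N _ x hx => by
    have := N.smul_mem r hx
    rw [Finset.smul_sum] at this
    simpa only [Algebra.algebraMap_eq_smul_one, Matrix.smul_mulVec, Matrix.one_mulVec,
      Pi.smul_apply, smul_eq_mul, mul_smul] using this

lemma mem_stabilizer_of_operator {β : A} [Fintype {m : Multiset Φ // mwt wt m = β}]
    {T : Module.End R M} (hT : ∀ N, S.IsCasimirStable N → ∀ x ∈ N, T x ∈ N)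
    {G : Matrix {m : Multiset Φ // mwt wt m = β} {m : Multiset Φ // mwt wt m = β} R}
    (hG : ∀ j : {m : Multiset Φ // mwt wt m = β}, T (S.y j) = ∑ i, G i j • S.y i) :
    G ∈ S.stabilizer wt β := by
  intro N hN x hx
  convert hT N hN _ hx using 1
  simp only [map_sum, map_smul, hG, Finset.smul_sum, Matrix.mulVec, dotProduct, Finset.sum_smul]
  rw [Finset.sum_comm]
  refine Finset.sum_congr rfl fun i _ => Finset.sum_congr rfl fun j _ => ?_
  rw [smul_smul, mul_comm]

/-- The combinatorial hypotheses on the structure constants: heights are positive, and modulo `χ`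
every index outside `D` splits into two others. -/
structure IsAdmissible {k : Type*} [Field k] (C : Constants Φ R) (wt : Φ → A) (χ : R →+* k)
    (ht : A →+ k) (d : Φ → ℕ) (D : Set Φ) : Prop where
  graded : C.IsGraded wt
  χ_s : χ C.s = 0
  χ_h : ∀ α, χ (C.h α) ≠ 0
  ht_wt : ∀ α, ht (wt α) = d α
  d_pos : ∀ α, 0 < d α
  unique : ∀ m m' : Multiset Φ, (∀ α ∈ m, α ∈ D) → (∀ α ∈ m', α ∈ D) →
    mwt wt m = mwt wt m' → m = m'
  split : ∀ α, α ∉ D → ∃ γ δ, wt α = wt γ + wt δ ∧ χ (C.c α γ δ) ≠ 0 ∧ χ (C.b γ α δ) ≠ 0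

namespace IsAdmissible

variable {k : Type*} [Field k] [CharZero k] {χ : R →+* k} {ht : A →+ k} {d : Φ → ℕ} {D : Set Φ}
  (hA : IsAdmissible C wt χ ht d D)

include hA

omit [Fintype Φ] [DecidableEq Φ] in
lemma wt_ne_zero (α : Φ) : wt α ≠ 0 := by
  intro h
  have := hA.ht_wt α
  rw [h, map_zero] at this
  exact (hA.d_pos α).ne (by exact_mod_cast this)

omit [Fintype Φ] [DecidableEq Φ] in
lemma d_add {α γ δ : Φ} (h : wt α = wt γ + wt δ) : d α = d γ + d δ := by
  have := hA.ht_wt α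
  rw [h, map_add, hA.ht_wt, hA.ht_wt] at this
  exact_mod_cast this.symm

omit [Fintype Φ] [DecidableEq Φ] in
lemma ht_mwt (m : Multiset Φ) : ht (mwt wt m) = ((m.map d).sum : ℕ) := by
  induction m using Multiset.induction_on with
  | empty => simp
  | cons α m ih => simp [ih, hA.ht_wt]

omit [Fintype Φ] [DecidableEq Φ] in
lemma card_le {m m' : Multiset Φ} (h : mwt wt m = mwt wt m') : m.card ≤ (m'.map d).sum := by
  have h1 := hA.ht_mwt m
  rw [h, hA.ht_mwt] at h1
  have h2 : (m'.map d).sum = (m.map d).sum := by exact_mod_cast h1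
  rw [h2]
  have := Multiset.card_nsmul_le_sum (s := m.map d) (a := 1) (by
    intro x hx
    obtain ⟨α, _, rfl⟩ := Multiset.mem_map.1 hx
    exact hA.d_pos α)
  simpa using this

lemma finite (β : A) : Finite {m : Multiset Φ // mwt wt m = β} := by
  classical
  by_cases hne : Nonempty {m : Multiset Φ // mwt wt m = β}
  · obtain ⟨m', hm'⟩ := hne
    refine Set.Finite.subset (Set.finite_Iic ((m'.map d).sum • (Finset.univ : Finset Φ).val))
      fun m hm => ?_
    refine Multiset.le_iff_count.2 fun α => ?_
    rw [Multiset.count_nsmul, Multiset.count_univ, mul_one]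
    exact (Multiset.count_le_card _ _).trans (hA.card_le (hm.trans hm'.symm))
  · rw [not_nonempty_iff] at hne
    infer_instance

omit [DecidableEq Φ] in
lemma bracketOp_mem {α γ δ : Φ} (h : wt α = wt γ + wt δ) {N : Submodule R M}
    (hN : S.IsCasimirStable N) {x : M} (hx : x ∈ N) : S.bracketOp α γ x ∈ N := by
  refine hN.2 _ ?_
  have hd := hA.d_add h
  have hne : α ≠ γ := by
    rintro rfl
    have := hA.d_pos δ
    omega
  have := S.commutator_eq hne (fun ε => ?_) (fun ε => ?_)
  · rw [← LinearMap.smul_apply, ← this]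
    exact sub_mem (hN.1 _ _ (hN.1 _ _ hx)) (hN.1 _ _ (hN.1 _ _ hx))
  · by_contra h0
    have := hA.d_add (hA.graded.b_supp _ _ _ h0)
    have := hA.d_pos δ
    omega
  · by_contra h0
    have := hA.d_add (hA.graded.c_supp _ _ _ h0)
    have := hA.d_pos δ
    omega

variable (S)

lemma reduction_stabilizer (hχ : Function.Surjective χ) (β : A)
    [Fintype {m : Multiset Φ // mwt wt m = β}] :
    reduction χ hχ (S.stabilizer wt β) = ⊤ := by
  refine subalgebra_eq_top _ ?_ ?_
  · intro i j hij
    have : ∃ α, i.1.count α ≠ j.1.count α := by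
      by_contra! h
      exact hij (Subtype.ext (Multiset.ext.2 h))
    obtain ⟨α, hα⟩ := this
    obtain ⟨G, hG, hGχ⟩ := (hasSymbol_mul_self (S := S) hA.graded α).exists_matrix χ hA.χ_s β
    refine ⟨fun l => (l.1.count α : k) * χ (C.h α), ⟨G, mem_stabilizer_of_operator
      (fun N hN x hx => hN.1 α x hx) hG, ?_⟩, ?_⟩
    · ext a b
      rw [RingHom.mapMatrix_apply, Matrix.map_apply, hGχ, mul_self_symbol_apply,
        Matrix.diagonal_apply]
      by_cases hab : a = b
      · subst hab; simp
      · rw [if_neg hab, if_neg (fun h => hab (Subtype.ext h.symm)), map_zero]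
    · intro h
      exact hα (by exact_mod_cast mul_right_cancel₀ (hA.χ_h α) h)
  · have hstep : ∀ (i : {m : Multiset Φ // mwt wt m = β}), (∃ α ∈ i.1, α ∉ D) →
        ∃ j : {m : Multiset Φ // mwt wt m = β}, j.1.card = i.1.card + 1 ∧
          (∃ W ∈ reduction χ hχ (S.stabilizer wt β), W i j ≠ 0) ∧
          ∃ W ∈ reduction χ hχ (S.stabilizer wt β), W j i ≠ 0 := by
      rintro ⟨i, hi⟩ ⟨α, hαi, hαD⟩
      obtain ⟨m, rfl⟩ := Multiset.exists_cons_of_mem hαi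
      obtain ⟨γ, δ, hw, hc, hb⟩ := hA.split α hαD
      have hd := hA.d_add hw
      have hγ : γ ≠ α := by
        rintro rfl
        have := hA.d_pos δ
        omega
      have hδ : δ ≠ α := by
        rintro rfl
        have := hA.d_pos γ
        omega
      obtain ⟨G, hG, hGχ⟩ :=
        (hasSymbol_bracketOp (S := S) hA.graded α γ).exists_matrix χ hA.χ_s β
      have hGm : G.map χ ∈ reduction χ hχ (S.stabilizer wt β) :=
        ⟨G, mem_stabilizer_of_operator (fun N hN x hx => hA.bracketOp_mem hw hN hx) hG, rfl⟩
      refine ⟨⟨γ ::ₘ δ ::ₘ m, by simpa [hw, add_assoc] using hi⟩, by simp, ⟨_, hGm, ?_⟩,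
        ⟨_, hGm, ?_⟩⟩
      · rw [Matrix.map_apply, hGχ, bracketSymbol_merge hA.graded hγ hδ hA.wt_ne_zero]
        simp only [map_mul, map_natCast]
        refine mul_ne_zero hc (mul_ne_zero (mul_ne_zero ?_ (hA.χ_h γ))
          (mul_ne_zero ?_ (hA.χ_h δ))) <;>
          exact Nat.cast_ne_zero.2 (Multiset.count_ne_zero.2 (Multiset.mem_cons_self _ _))
      · rw [Matrix.map_apply, hGχ, bracketSymbol_split hA.graded hγ hδ hA.wt_ne_zero]
        simp only [map_mul, map_natCast, map_neg]
        refine mul_ne_zero (neg_ne_zero.2 hb) (mul_ne_zero ?_ (hA.χ_h α))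
        exact Nat.cast_ne_zero.2 (Multiset.count_ne_zero.2 (Multiset.mem_cons_self _ _))
    set r := fun i j : {m : Multiset Φ // mwt wt m = β} =>
      (∃ W ∈ reduction χ hχ (S.stabilizer wt β), W i j ≠ 0) ∧
          ∃ W ∈ reduction χ hχ (S.stabilizer wt β), W j i ≠ 0
    have hmax : ∀ (n : ℕ) (i : {m : Multiset Φ // mwt wt m = β}),
        (i.1.map d).sum ≤ i.1.card + n →
        ∃ j : {m : Multiset Φ // mwt wt m = β}, (∀ α ∈ j.1, α ∈ D) ∧ Relation.EqvGen r i j := by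
      intro n
      induction n with
      | zero =>
        intro i hn
        refine ⟨i, ?_, .refl i⟩
        by_contra! h
        obtain ⟨j, hj, -⟩ := hstep i h
        have := hA.card_le (j.2.trans i.2.symm)
        omega
      | succ n ih =>
        intro i hn
        by_cases h : ∃ α ∈ i.1, α ∉ D
        · obtain ⟨j, hj, hr⟩ := hstep i h
          have hij : (j.1.map d).sum = (i.1.map d).sum := by
            have h1 := hA.ht_mwt j.1
            rw [j.2.trans i.2.symm, hA.ht_mwt] at h1
            exact_mod_cast h1.symm
          obtain ⟨l, hl, hl'⟩ := ih j (by omega)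
          exact ⟨l, hl, .trans _ _ _ (.rel _ _ hr) hl'⟩
        · push Not at h
          exact ⟨i, h, .refl i⟩
    intro i j
    obtain ⟨i', hi', hi⟩ := hmax _ i (Nat.le_add_left _ _)
    obtain ⟨j', hj', hj⟩ := hmax _ j (Nat.le_add_left _ _)
    have : i' = j' := Subtype.ext (hA.unique _ _ hi' hj' (i'.2.trans j'.2.symm))
    subst this
    exact .trans _ _ _ hi (.symm _ _ hj)

/-- Generic irreducibility: a Casimir stable submodule containing a combination of monomials of
weight `β` contains a multiple of each monomial by `Q` times each of the coefficients. -/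
theorem exists_generic (hχ : Function.Surjective χ) (β : A)
    [Fintype {m : Multiset Φ // mwt wt m = β}] :
    ∃ Q : R, χ Q ≠ 0 ∧ ∀ N, S.IsCasimirStable N →
      ∀ x : {m : Multiset Φ // mwt wt m = β} → R, ∑ i, x i • S.y i ∈ N →
        ∀ i j : {m : Multiset Φ // mwt wt m = β}, (Q * x j) • S.y i ∈ N := by
  obtain ⟨Q, hQ, h⟩ := exists_smul_single_mem (hA.reduction_stabilizer S hχ β)
  refine ⟨Q, hQ, fun N hN x hx i j => ?_⟩
  have := h i j N hN x hx
  rw [Finset.sum_eq_single i] at this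
  · rwa [Matrix.smul_mulVec, Matrix.single_mulVec, Pi.smul_apply, Function.update_self, one_mul]
      at this
  · intro l _ hl
    rw [Matrix.smul_mulVec, Matrix.single_mulVec, Pi.smul_apply, Function.update_of_ne hl,
      Pi.zero_apply, smul_zero, zero_smul]
  · simp

end IsAdmissible

section Family

variable {k T : Type*} [Field k] [Algebra k R] (ev : T → R →ₐ[k] k) {V : T → Type*}
  [∀ p, AddCommGroup (V p)] [∀ p, Module k (V p)]

/-- The image of structure constants under a map. -/
def _root_.TriangularDeformation.Constants.map {Φ R R' : Type*} (C : Constants Φ R) (φ : R → R') :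
    Constants Φ R' where
  s := φ C.s
  h α := φ (C.h α)
  k α γ := φ (C.k α γ)
  a α γ ε := φ (C.a α γ ε)
  b α γ ε := φ (C.b α γ ε)
  c α γ ε := φ (C.c α γ ε)
  g α γ ε := φ (C.g α γ ε)

/-- The product of the modules `V p`, as a module over the ring of parameters. -/
@[reducible] def familyModule : Module R (∀ p, V p) :=
  letI : ∀ p, Module R (V p) := fun p => Module.compHom (V p) (ev p).toRingHom
  inferInstance

/-- The endomorphism of the product of a family induced by endomorphisms of its members. -/
def familyEnd (f : ∀ p, Module.End k (V p)) :
    @Module.End R (∀ p, V p) _ _ (familyModule ev) :=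
  letI := familyModule (R := R) (V := V) ev
  { toFun := fun x p => f p (x p)
    map_add' := fun _ _ => funext fun _ => map_add _ _ _
    map_smul' := fun r x => funext fun p => map_smul (f p) (ev p r) (x p) }

/-- A family of systems over the points of a parameter space is a system over its ring of
functions. -/
def family (S : ∀ p, System (C.map (ev p)) (V p)) :
    letI := familyModule (R := R) (V := V) ev
    System C (∀ p, V p) :=
  letI := familyModule (R := R) (V := V) ev
  { E := fun α => familyEnd ev fun p => (S p).E α
    F := fun α => familyEnd ev fun p => (S p).F α
    H := fun α => familyEnd ev fun p => (S p).H α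
    v := fun p => (S p).v
    E_v := fun α => funext fun p => (S p).E_v α
    H_v := fun α => funext fun p => (S p).H_v α
    EF_self := fun α => LinearMap.ext fun x => funext fun p =>
      congrArg (fun T : Module.End k (V p) => T (x p)) ((S p).EF_self α)
    HF := fun α γ => LinearMap.ext fun x => funext fun p => by
      have := congrArg (fun T : Module.End k (V p) => T (x p)) ((S p).HF α γ)
      refine this.trans ?_
      simp only [LinearMap.add_apply, LinearMap.smul_apply, Pi.add_apply, Constants.map, ← map_mul]
      rfl
    EF := fun α γ h => LinearMap.ext fun x => funext fun p => by
      have := congrArg (fun T : Module.End k (V p) => T (x p)) ((S p).EF α γ h)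
      refine this.trans ?_
      simp only [LinearMap.add_apply, LinearMap.smul_apply, LinearMap.sum_apply, Pi.add_apply,
        Pi.smul_apply, Finset.sum_apply, Constants.map]
      rfl
    FF := fun α γ => LinearMap.ext fun x => funext fun p => by
      have := congrArg (fun T : Module.End k (V p) => T (x p)) ((S p).FF α γ)
      refine this.trans ?_
      simp only [LinearMap.add_apply, LinearMap.smul_apply, LinearMap.sum_apply, Pi.add_apply,
        Pi.smul_apply, Finset.sum_apply, Constants.map]
      rfl
    EE := fun α γ => LinearMap.ext fun x => funext fun p => by
      have := congrArg (fun T : Module.End k (V p) => T (x p)) ((S p).EE α γ)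
      refine this.trans ?_
      simp only [LinearMap.add_apply, LinearMap.smul_apply, LinearMap.sum_apply, Pi.add_apply,
        Pi.smul_apply, Finset.sum_apply, Constants.map]
      rfl }

omit [DecidableEq Φ] in
lemma family_y (S : ∀ p, System (C.map (ev p)) (V p)) (m : Multiset Φ) (p : T) :
    letI := familyModule (R := R) (V := V) ev
    (family ev S).y m p = (S p).y m := by
  let := familyModule (R := R) (V := V) ev
  suffices h : ∀ w : List Φ, (family ev S).word w p = (S p).word w from h _
  intro w
  induction w with
  | nil => rfl
  | cons α w ih =>
    rw [word_cons, word_cons, ← ih]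
    rfl

/-- Generic irreducibility for a family of systems. -/
theorem IsAdmissible.exists_generic_family [CharZero k] {χ : R →ₐ[k] k} {ht : A →+ k} {d : Φ → ℕ}
    {D : Set Φ} (hA : IsAdmissible C wt (χ : R →+* k) ht d D)
    (S : ∀ p, System (C.map (ev p)) (V p)) (β : A) [Fintype {m : Multiset Φ // mwt wt m = β}] :
    ∃ Q : R, χ Q ≠ 0 ∧ ∀ p, ev p C.s ≠ 0 → ∀ N : Submodule k (V p),
      (∀ α, ∀ x ∈ N, (S p).F α ((S p).E α x) ∈ N) →
      ∀ c : {m : Multiset Φ // mwt wt m = β} → k, ∑ i, c i • (S p).y i ∈ N →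
        ∀ i j : {m : Multiset Φ // mwt wt m = β}, (ev p Q * c j) • (S p).y i ∈ N := by
  let := familyModule (R := R) (V := V) ev
  obtain ⟨Q, hQ, h⟩ := hA.exists_generic (family ev S)
    (fun z => ⟨algebraMap k R z, by simp⟩) β
  refine ⟨Q, hQ, fun p hp N hN c hc i j => ?_⟩
  let N' : Submodule R (∀ p, V p) :=
    { carrier := {x | x p ∈ N}
      add_mem' := fun hx hy => N.add_mem hx hy
      zero_mem' := N.zero_mem
      smul_mem' := fun r x hx => N.smul_mem (ev p r) hx }
  have hN' : (family ev S).IsCasimirStable N' :=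
    ⟨fun α x hx => hN α _ hx, fun x hx => (N.smul_mem_iff hp).1 hx⟩
  have := h N' hN' (fun l => algebraMap k R (c l)) (by
    change (∑ l, algebraMap k R (c l) • (family ev S).y l.1) p ∈ N
    convert hc using 1
    rw [Finset.sum_apply]
    refine Finset.sum_congr rfl fun l _ => ?_
    rw [← family_y ev S]
    refine Eq.trans (b := ev p (algebraMap k R (c l)) • (family ev S).y l.1 p) rfl ?_
    rw [AlgHom.commutes, Algebra.algebraMap_self, RingHom.id_apply]) i j
  change ev p (Q * algebraMap k R (c j)) • ((family ev S).y i.1 p) ∈ N at this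
  rwa [family_y, map_mul, AlgHom.commutes, Algebra.algebraMap_self, RingHom.id_apply] at this

end Family

end System

end TriangularDeformation

section RootVectors

variable {L : Type} [LieRing L] [LieAlgebra ℂ L] {H : LieSubalgebra ℂ L}

lemma IsRootVector.lie {α γ : Module.Dual ℂ H} {x y : L} (hx : IsRootVector H α x)
    (hy : IsRootVector H γ y) : IsRootVector H (α + γ) ⁅x, y⁆ := by
  intro t
  rw [leibniz_lie, hx t, hy t, smul_lie, lie_smul, LinearMap.add_apply, add_smul]

lemma IsRootVector.smul {α : Module.Dual ℂ H} {x : L} (hx : IsRootVector H α x) (c : ℂ) :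
    IsRootVector H α (c • x) := by
  intro t
  rw [lie_smul, hx t, smul_comm]

variable [FiniteDimensional ℂ L] [H.IsCartanSubalgebra]

omit [FiniteDimensional ℂ L] in
lemma IsRootVector.mem_rootSpace {α : Module.Dual ℂ H} {x : L} (hx : IsRootVector H α x) :
    x ∈ rootSpace H α :=
  LieModule.weightSpace_le_genWeightSpace L (α : H → ℂ)
    ((LieModule.mem_weightSpace (α : H → ℂ) x).2 hx)

omit [FiniteDimensional ℂ L] in
/-- A functional admitting a root vector is a weight. -/
lemma IsRootVector.exists_weight {α : Module.Dual ℂ H} {x : L} (hx : IsRootVector H α x)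
    (h0 : x ≠ 0) : ∃ w : LieModule.Weight ℂ H L, (w : H → ℂ) = α :=
  ⟨⟨α, fun h => h0 (by simpa [h] using hx.mem_rootSpace)⟩, rfl⟩

variable [LieAlgebra.IsSemisimple ℂ L]

lemma isRootVector_of_mem_rootSpace {α : Module.Dual ℂ H} {x : L} (hx : x ∈ rootSpace H α) :
    IsRootVector H α x :=
  fun t => IsKilling.lie_eq_smul_of_mem_rootSpace hx t

/-- Root spaces are one-dimensional. -/
lemma IsRootVector.exists_eq_smul {α : Module.Dual ℂ H} (hα : α ≠ 0) {x y : L}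
    (hx : IsRootVector H α x) (h0 : x ≠ 0) (hy : IsRootVector H α y) : ∃ c : ℂ, c • x = y := by
  obtain ⟨w, hw⟩ := hx.exists_weight h0
  have hw0 : w.IsNonZero := by
    intro h
    refine hα (LinearMap.ext fun t => ?_)
    have := congrFun hw t
    rw [h] at this
    exact this.symm
  have h1 := IsKilling.finrank_rootSpace_eq_one w hw0
  have hxw : x ∈ rootSpace H w := by rw [hw]; exact hx.mem_rootSpace
  have hyw : y ∈ rootSpace H w := by rw [hw]; exact hy.mem_rootSpace
  obtain ⟨c, hc⟩ := (finrank_eq_one_iff_of_nonzero' (⟨x, hxw⟩ : rootSpace H w)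
    (fun h => h0 (congrArg Subtype.val h))).1 h1 ⟨y, hyw⟩
  exact ⟨c, congrArg Subtype.val hc⟩

/-- A subspace containing the Cartan subalgebra and all root vectors is everything. -/
lemma eq_top_of_rootVectors_mem (W : Submodule ℂ L) (hH : ∀ t : H, (t : L) ∈ W)
    (hW : ∀ α : Module.Dual ℂ H, α ≠ 0 → ∀ x, IsRootVector H α x → x ∈ W) : W = ⊤ := by
  have h := LieModule.iSup_genWeightSpace_eq_top' ℂ H L
  rw [← LieSubmodule.toSubmodule_inj, LieSubmodule.iSup_toSubmodule] at h
  rw [eq_top_iff, ← LieSubmodule.top_toSubmodule (R := ℂ) (L := H) (M := L), ← h]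
  refine iSup_le fun w x hx => ?_
  by_cases h0 : w.toLinear = 0
  · have hw : (w : H → ℂ) = 0 := by
      ext t
      exact LinearMap.congr_fun h0 t
    have hx' : x ∈ rootSpace H (0 : H → ℂ) := by
      rw [← hw]; exact hx
    rw [rootSpace_zero_eq] at hx'
    exact hH ⟨x, hx'⟩
  · exact hW w.toLinear h0 x (isRootVector_of_mem_rootSpace hx)

omit [LieAlgebra.IsSemisimple ℂ L] in
/-- There are finitely many roots. -/
lemma finite_roots (s : Set (Module.Dual ℂ H))
    (hs : ∀ α ∈ s, ∃ x : L, x ≠ 0 ∧ IsRootVector H α x) : s.Finite := by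
  refine (Set.finite_range fun w : LieModule.Weight ℂ H L => w.toLinear).subset ?_
  intro α hα
  obtain ⟨x, h0, hx⟩ := hs α hα
  obtain ⟨w, hw⟩ := hx.exists_weight h0
  exact ⟨w, LinearMap.ext fun t => congrFun hw t⟩

omit [LieAlgebra.IsSemisimple ℂ L] [FiniteDimensional ℂ L] [H.IsCartanSubalgebra] in
lemma isSl2Triple_of_rootVectors {γ : Module.Dual ℂ H} {e f : L} {h : H}
    (he : IsRootVector H γ e) (hf : IsRootVector H (-γ) f) (hef : ⁅e, f⁆ = (h : L))
    (h2 : γ h = 2) : IsSl2Triple (h : L) e f where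
  h_ne_zero := by
    intro h0
    have : h = 0 := Subtype.ext h0
    simp [this] at h2
  lie_e_f := hef
  lie_h_e_nsmul := by rw [he h, h2, ← Nat.cast_smul_eq_nsmul ℂ]; rfl
  lie_h_f_nsmul := by
    rw [hf h, LinearMap.neg_apply, h2, neg_smul, ← Nat.cast_smul_eq_nsmul ℂ]; rfl

omit [LieAlgebra.IsSemisimple ℂ L] [H.IsCartanSubalgebra] in
/-- The bracket with a raising operator does not vanish on vectors of negative weight. -/
lemma lie_ne_zero_of_isSl2Triple {h e f x : L} (ht : IsSl2Triple h e f) (hx : x ≠ 0) {c : ℂ}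
    (hc : ⁅h, x⁆ = c • x) (hn : ¬ ∃ n : ℕ, c = n) : ⁅e, x⁆ ≠ 0 := fun h0 =>
  hn (IsSl2Triple.HasPrimitiveVectorWith.exists_nat (t := ht) ⟨hx, hc, h0⟩)

/-- The signs of the two Cartan integers of a pair of roots agree. -/
lemma cartan_integer_sign {α γ : Module.Dual ℂ H} {e f e' f' : L} {h h' : H}
    (he : IsRootVector H α e) (hf : IsRootVector H (-α) f) (hef : ⁅e, f⁆ = (h : L))
    (h2 : α h = 2) (he' : IsRootVector H γ e') (hf' : IsRootVector H (-γ) f')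
    (hef' : ⁅e', f'⁆ = (h' : L)) (h2' : γ h' = 2) :
    ∃ a b : ℤ, α h' = a ∧ γ h = b ∧ (0 < a ↔ 0 < b) := by
  have key : ∀ {α : Module.Dual ℂ H} {e f : L} {h : H}, IsRootVector H α e →
      IsRootVector H (-α) f → ⁅e, f⁆ = (h : L) → α h = 2 →
      ∃ w : H.root, (∀ t, w.1 t = α t) ∧ h = IsKilling.coroot w.1 := by
    intro α e f h he hf hef h2
    have ht := isSl2Triple_of_rootVectors he hf hef h2
    obtain ⟨w, hw⟩ := he.exists_weight ht.e_ne_zero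
    have hw0 : w.IsNonZero := by
      intro h0
      have := congrFun hw h
      rw [h0, h2] at this
      simp at this
    refine ⟨⟨w, by simpa using hw0⟩, fun t => congrFun hw t, Subtype.ext ?_⟩
    refine ht.h_eq_coroot hw0 ?_ ?_
    · rw [hw]; exact he.mem_rootSpace
    · rw [hw]; exact hf.mem_rootSpace
  obtain ⟨w, hw, rfl⟩ := key he hf hef h2
  obtain ⟨w', hw', rfl⟩ := key he' hf' hef' h2'
  refine ⟨(IsKilling.rootSystem H).pairingIn ℤ w w', (IsKilling.rootSystem H).pairingIn ℤ w' w,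
    ?_, ?_, (IsKilling.rootSystem H).zero_lt_pairingIn_iff' ℤ⟩
  · rw [← hw, ← IsKilling.rootSystem_pairing_apply,
      ← (IsKilling.rootSystem H).algebraMap_pairingIn ℤ]
    rfl
  · rw [← hw', ← IsKilling.rootSystem_pairing_apply,
      ← (IsKilling.rootSystem H).algebraMap_pairingIn ℤ]
    rfl

lemma lie_cartan (s t : H) : ⁅(s : L), (t : L)⁆ = 0 := by
  have := LieModule.IsTrivial.trivial (L := H) (M := H) s t
  exact congrArg Subtype.val this

end RootVectors

section Positive

variable {L : Type} [LieRing L] [LieAlgebra ℂ L]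

/-- A system of positive roots with simple roots `Δ`, together with a choice of root vectors and
coroots. -/
structure PositiveSystem (H : LieSubalgebra ℂ L) (R Rp : Set (Module.Dual ℂ H))
    (Δ : Finset (Module.Dual ℂ H)) (e f : Module.Dual ℂ H → L) (hcoroot : Module.Dual ℂ H → H) :
    Prop where
  mem_iff : ∀ α, α ∈ R ↔ α ≠ 0 ∧ ∃ x : L, x ≠ 0 ∧ IsRootVector H α x
  pos_sub : Rp ⊆ R
  pos_or_neg : ∀ α ∈ R, α ∈ Rp ∨ -α ∈ Rp
  simple_sub : (Δ : Set (Module.Dual ℂ H)) ⊆ Rp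
  linearIndependent : LinearIndependent ℂ (Subtype.val : {x // x ∈ Δ} → Module.Dual ℂ H)
  exists_sum : ∀ α ∈ Rp, ∃ k : Δ → ℕ, α = ∑ a : Δ, (k a : ℂ) • (a : Module.Dual ℂ H)
  e_root : ∀ α ∈ R, IsRootVector H α (e α) ∧ e α ≠ 0
  f_root : ∀ α ∈ R, IsRootVector H (-α) (f α) ∧ f α ≠ 0
  lie_e_f : ∀ α ∈ R, ⁅e α, f α⁆ = (hcoroot α : L)
  apply_coroot : ∀ α ∈ R, α (hcoroot α) = 2

namespace PositiveSystem

variable {H : LieSubalgebra ℂ L} {R Rp : Set (Module.Dual ℂ H)}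
  {Δ : Finset (Module.Dual ℂ H)} {e f : Module.Dual ℂ H → L} {hcoroot : Module.Dual ℂ H → H}
  (P : PositiveSystem H R Rp Δ e f hcoroot)

include P

lemma ne_zero (α : Rp) : α.1 ≠ 0 := ((P.mem_iff α).1 (P.pos_sub α.2)).1

/-- The height function. -/
lemma exists_height : ∃ (ht : Module.Dual ℂ (Module.Dual ℂ H)) (d : Rp → ℕ),
    (∀ a ∈ Δ, ht a = 1) ∧ (∀ α : Rp, ht α = d α) ∧ ∀ α, 0 < d α := by
  obtain ⟨ht, hht⟩ := Module.exists_dual_forall_apply_eq_one (K := ℂ) (s := Set.univ)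
    (linearIndepOn_univ_iff.2 P.linearIndependent)
  have h1 : ∀ a : Δ, ht a = 1 := fun a => hht a trivial
  choose k hk using fun α : Rp => P.exists_sum α α.2
  refine ⟨ht, fun α => ∑ a, k α a, fun a ha => h1 ⟨a, ha⟩, fun α => ?_, fun α => ?_⟩
  · conv_lhs => rw [hk α]
    simp [h1]
  · by_contra h0
    have h0 : ∀ a, k α a = 0 := by simpa using h0
    refine P.ne_zero α ?_
    rw [hk α]
    simp [h0]

/-- Multisets of simple roots are determined by their sums. -/
lemma eq_of_sum_eq (m m' : Multiset Rp) (hm : ∀ α ∈ m, α.1 ∈ Δ) (hm' : ∀ α ∈ m', α.1 ∈ Δ)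
    (h : (m.map Subtype.val).sum = (m'.map Subtype.val).sum) : m = m' := by
  classical
  obtain ⟨g, hg⟩ := LinearMap.exists_leftInverse_of_injective _
    (LinearMap.ker_eq_bot.2 P.linearIndependent)
  have hg : ∀ a : Δ, g a.1 = Finsupp.single a 1 := fun a => by
    have := LinearMap.congr_fun hg (Finsupp.single a 1)
    simpa using this
  have key : ∀ m : Multiset Rp, (∀ α ∈ m, α.1 ∈ Δ) → ∀ (α : Rp) (hα : α.1 ∈ Δ),
      g (m.map Subtype.val).sum ⟨α, hα⟩ = m.count α := by
    intro m
    induction m using Multiset.induction_on with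
    | empty => intro _ α hα; simp
    | cons γ m ih =>
      intro hm α hα
      have hγ := hm γ (Multiset.mem_cons_self _ _)
      rw [Multiset.map_cons, Multiset.sum_cons, map_add, Finsupp.add_apply,
        ih (fun δ hδ => hm δ (Multiset.mem_cons_of_mem hδ)), hg ⟨γ, hγ⟩, Finsupp.single_apply,
        Multiset.count_cons]
      by_cases hαγ : α = γ
      · subst hαγ; simp [add_comm]
      · rw [if_neg, if_neg hαγ]
        · simp
        · intro h
          exact hαγ (Subtype.ext (congrArg Subtype.val h).symm)
  refine Multiset.ext.2 fun α => ?_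
  by_cases hα : α.1 ∈ Δ
  · have h1 := key m hm α hα
    rw [h, key m' hm' α hα] at h1
    exact_mod_cast h1.symm
  · rw [Multiset.count_eq_zero_of_notMem fun h => hα (hm α h),
      Multiset.count_eq_zero_of_notMem fun h => hα (hm' α h)]

variable [FiniteDimensional ℂ L] [H.IsCartanSubalgebra] [LieAlgebra.IsSemisimple ℂ L]

/-- Any root vector is a multiple of one of the chosen ones. -/
lemma exists_eq_sum [Fintype Rp] {θ : Module.Dual ℂ H} (hθ : θ ≠ 0) {x : L}
    (hx : IsRootVector H θ x) : ∃ b c : Rp → ℂ,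
      x = ∑ ε, b ε • f ε + ∑ ε, c ε • e ε ∧ (∀ ε, b ε ≠ 0 → θ = -ε.1) ∧
        ∀ ε, c ε ≠ 0 → θ = ε := by
  classical
  by_cases h0 : x = 0
  · exact ⟨0, 0, by simp [h0]⟩
  have hR : θ ∈ R := (P.mem_iff θ).2 ⟨hθ, x, h0, hx⟩
  rcases P.pos_or_neg θ hR with h | h
  · obtain ⟨he, he0⟩ := P.e_root θ hR
    obtain ⟨c, rfl⟩ := he.exists_eq_smul hθ he0 hx
    refine ⟨0, Pi.single ⟨θ, h⟩ c, ?_, by simp, fun ε hε => ?_⟩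
    · simp [Pi.single_apply]
    · by_contra hne
      exact hε (Pi.single_eq_of_ne (fun h => hne (congrArg Subtype.val h).symm) _)
  · obtain ⟨hf, hf0⟩ := P.f_root (-θ) (P.pos_sub h)
    rw [neg_neg] at hf
    obtain ⟨c, rfl⟩ := hf.exists_eq_smul hθ hf0 hx
    refine ⟨Pi.single ⟨-θ, h⟩ c, 0, ?_, fun ε hε => ?_, by simp⟩
    · simp [Pi.single_apply]
    · by_contra hne
      refine hε (Pi.single_eq_of_ne (fun h => hne ?_) _)
      rw [h, neg_neg]

/-- A positive root pairs positively with some simple coroot. -/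
lemma exists_simple_pos (α : Rp) : ∃ γ : Rp, γ.1 ∈ Δ ∧ ∃ n : ℤ, 0 < n ∧ α.1 (hcoroot γ) = n := by
  obtain ⟨k, hk⟩ := P.exists_sum α α.2
  have hα := P.pos_sub α.2
  by_contra! hcon
  have h : ∀ γ : Δ, ∃ n : ℤ, n ≤ 0 ∧ γ.1 (hcoroot α) = n := by
    intro γ
    have hγ := P.pos_sub (P.simple_sub γ.2)
    obtain ⟨n, m, hn, hm, hs⟩ := cartan_integer_sign (P.e_root α hα).1 (P.f_root α hα).1
      (P.lie_e_f α hα) (P.apply_coroot α hα) (P.e_root γ hγ).1 (P.f_root γ hγ).1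
      (P.lie_e_f γ hγ) (P.apply_coroot γ hγ)
    refine ⟨m, not_lt.1 fun h => ?_, hm⟩
    exact hcon ⟨γ, P.simple_sub γ.2⟩ γ.2 n (hs.2 h) hn
  choose n hn hγ using h
  have h2 := P.apply_coroot α hα
  have h3 : α.1 (hcoroot α) = ((∑ a : Δ, (k a : ℤ) * n a : ℤ) : ℂ) := by
    have h3 := LinearMap.congr_fun hk (hcoroot α)
    simp only [LinearMap.sum_apply, LinearMap.smul_apply, hγ, smul_eq_mul] at h3
    rw [h3]
    push_cast
    rfl
  rw [h3] at h2
  have h4 : ∑ a : Δ, (k a : ℤ) * n a = 2 := by exact_mod_cast h2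
  have h5 : ∑ a : Δ, (k a : ℤ) * n a ≤ 0 :=
    Finset.sum_nonpos fun a _ => mul_nonpos_of_nonneg_of_nonpos (by positivity) (hn a)
  omega

/-- The root vectors of a positive root have nonzero brackets with those of some simple root. -/
lemma exists_lie_ne_zero (α : Rp) : ∃ γ : Rp, γ.1 ∈ Δ ∧
    ⁅e α, f γ⁆ ≠ 0 ∧ ⁅e γ, f α⁆ ≠ 0 := by
  obtain ⟨γ, hγΔ, n, hn, hα⟩ := P.exists_simple_pos α
  have hγ := P.pos_sub γ.2
  have ht := isSl2Triple_of_rootVectors (P.e_root γ hγ).1 (P.f_root γ hγ).1 (P.lie_e_f γ hγ)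
    (P.apply_coroot γ hγ)
  have hnat : ¬ ∃ m : ℕ, (-n : ℂ) = m := by
    rintro ⟨m, hm⟩
    have : -n = m := by exact_mod_cast hm
    omega
  obtain ⟨he, he0⟩ := P.e_root α (P.pos_sub α.2)
  obtain ⟨hf, hf0⟩ := P.f_root α (P.pos_sub α.2)
  refine ⟨γ, hγΔ, ?_, ?_⟩
  · rw [← lie_skew, neg_ne_zero]
    refine lie_ne_zero_of_isSl2Triple ht.symm he0 (c := -n) ?_ hnat
    rw [neg_lie, he, hα, neg_smul]
  · refine lie_ne_zero_of_isSl2Triple ht hf0 (c := -n) ?_ hnat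
    rw [hf, LinearMap.neg_apply, hα]

end PositiveSystem

/-- Structure constants with respect to the chosen root vectors. -/
structure StructureConstants {H : LieSubalgebra ℂ L} (Rp : Set (Module.Dual ℂ H)) [Fintype Rp]
    (Δ : Finset (Module.Dual ℂ H)) (e f : Module.Dual ℂ H → L) where
  a : Rp → Rp → Rp → ℂ
  b : Rp → Rp → Rp → ℂ
  c : Rp → Rp → Rp → ℂ
  g : Rp → Rp → Rp → ℂ
  ff : ∀ α γ : Rp, ⁅f α, f γ⁆ = ∑ ε, a α γ ε • f ε
  ef : ∀ α γ : Rp, α ≠ γ → ⁅e α, f γ⁆ = ∑ ε, b α γ ε • f ε + ∑ ε, c α γ ε • e ε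
  ee : ∀ α γ : Rp, ⁅e α, e γ⁆ = ∑ ε, g α γ ε • e ε
  a_supp : ∀ α γ ε, a α γ ε ≠ 0 → ε.1 = α + γ
  b_supp : ∀ α γ ε, b α γ ε ≠ 0 → γ.1 = α + ε
  c_supp : ∀ α γ ε, c α γ ε ≠ 0 → α.1 = γ + ε
  g_supp : ∀ α γ ε, g α γ ε ≠ 0 → ε.1 = α + γ
  split : ∀ α : Rp, α.1 ∉ Δ → ∃ γ δ : Rp, α.1 = γ + δ ∧ c α γ δ ≠ 0 ∧ b γ α δ ≠ 0

lemma PositiveSystem.nonempty_structureConstants {H : LieSubalgebra ℂ L}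
    {R Rp : Set (Module.Dual ℂ H)} [Fintype Rp] {Δ : Finset (Module.Dual ℂ H)}
    {e f : Module.Dual ℂ H → L} {hcoroot : Module.Dual ℂ H → H} [FiniteDimensional ℂ L]
    [H.IsCartanSubalgebra] [LieAlgebra.IsSemisimple ℂ L]
    (P : PositiveSystem H R Rp Δ e f hcoroot) : Nonempty (StructureConstants Rp Δ e f) := by
  obtain ⟨ht, d, hΔ, hd, hpos⟩ := P.exists_height
  have he := fun α : Rp => (P.e_root α (P.pos_sub α.2)).1
  have hf := fun α : Rp => (P.f_root α (P.pos_sub α.2)).1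
  have hadd : ∀ {α γ : Rp}, α.1 + γ.1 ≠ 0 := by
    intro α γ h
    have := congrArg ht h
    rw [map_add, hd, hd, map_zero] at this
    have h1 : d α + d γ = 0 := by exact_mod_cast this
    have := hpos α
    omega
  have hadd3 : ∀ {α γ ε : Rp}, α.1 + γ.1 ≠ -ε := by
    intro α γ ε h
    have := congrArg ht h
    rw [map_add, map_neg, hd, hd, hd, eq_neg_iff_add_eq_zero] at this
    have h1 : d α + d γ + d ε = 0 := by exact_mod_cast this
    have := hpos α
    omega
  have hFF : ∀ α γ : Rp, ∃ a : Rp → ℂ, ⁅f α, f γ⁆ = ∑ ε, a ε • f ε ∧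
      ∀ ε, a ε ≠ 0 → ε.1 = α + γ := by
    intro α γ
    have hw : -α.1 + -γ.1 = -(α.1 + γ.1) := by abel
    obtain ⟨b, c, h, hb, hc⟩ := P.exists_eq_sum (hw ▸ neg_ne_zero.2 hadd) ((hf α).lie (hf γ))
    have hc0 : ∀ ε, c ε = 0 := fun ε => by
      by_contra h0
      have := hc ε h0
      rw [hw] at this
      exact hadd3 (neg_eq_iff_eq_neg.1 this)
    refine ⟨b, by simpa [hc0] using h, fun ε hε => ?_⟩
    have := hb ε hε
    rw [hw] at this
    exact (neg_injective this).symm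
  have hEE : ∀ α γ : Rp, ∃ a : Rp → ℂ, ⁅e α, e γ⁆ = ∑ ε, a ε • e ε ∧
      ∀ ε, a ε ≠ 0 → ε.1 = α + γ := by
    intro α γ
    obtain ⟨b, c, h, hb, hc⟩ := P.exists_eq_sum hadd ((he α).lie (he γ))
    have hb0 : ∀ ε, b ε = 0 := fun ε => by
      by_contra h0
      exact hadd3 (hb ε h0)
    exact ⟨c, by simpa [hb0] using h, fun ε hε => (hc ε hε).symm⟩
  have hEF : ∀ α γ : Rp, ∃ b c : Rp → ℂ, α ≠ γ →
      (⁅e α, f γ⁆ = ∑ ε, b ε • f ε + ∑ ε, c ε • e ε ∧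
      (∀ ε, b ε ≠ 0 → γ.1 = α + ε) ∧ ∀ ε, c ε ≠ 0 → α.1 = γ + ε) := by
    intro α γ
    by_cases hαγ : α = γ
    · exact ⟨0, 0, fun h => (h hαγ).elim⟩
    have hne : α.1 + -γ.1 ≠ 0 := by
      rw [← sub_eq_add_neg, sub_ne_zero]
      exact fun h => hαγ (Subtype.ext h)
    obtain ⟨b, c, h, hb, hc⟩ := P.exists_eq_sum hne ((he α).lie (hf γ))
    refine ⟨b, c, fun _ => ⟨h, fun ε hε => ?_, fun ε hε => ?_⟩⟩
    · have := hb ε hε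
      rw [← sub_eq_zero] at this ⊢
      rw [← neg_eq_zero, ← this]; abel
    · rw [← hc ε hε]; abel
  choose a ha ha' using hFF
  choose g hg hg' using hEE
  choose b c hbc using hEF
  let b' : Rp → Rp → Rp → ℂ := fun α γ ε => open Classical in if α = γ then 0 else b α γ ε
  let c' : Rp → Rp → Rp → ℂ := fun α γ ε => open Classical in if α = γ then 0 else c α γ ε
  have hb' : ∀ {α γ}, α ≠ γ → b' α γ = b α γ := fun h => funext fun ε => if_neg h
  have hc' : ∀ {α γ}, α ≠ γ → c' α γ = c α γ := fun h => funext fun ε => if_neg h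
  have hbs : ∀ α γ ε, b' α γ ε ≠ 0 → γ.1 = α + ε := by
    intro α γ ε h
    by_cases hαγ : α = γ
    · exact (h (if_pos hαγ)).elim
    · rw [hb' hαγ] at h
      exact (hbc α γ hαγ).2.1 ε h
  have hcs : ∀ α γ ε, c' α γ ε ≠ 0 → α.1 = γ + ε := by
    intro α γ ε h
    by_cases hαγ : α = γ
    · exact (h (if_pos hαγ)).elim
    · rw [hc' hαγ] at h
      exact (hbc α γ hαγ).2.2 ε h
  have hef : ∀ α γ : Rp, α ≠ γ → ⁅e α, f γ⁆ = ∑ ε, b' α γ ε • f ε + ∑ ε, c' α γ ε • e ε := by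
    intro α γ h
    rw [hb' h, hc' h]
    exact (hbc α γ h).1
  refine ⟨⟨a, b', c', g, ha, hef, hg, ha', hbs, hcs, hg', fun α hα => ?_⟩⟩
  obtain ⟨γ, hγ, h1, h2⟩ := P.exists_lie_ne_zero α
  have hne : α ≠ γ := by
    rintro rfl
    exact hα hγ
  have hdγ : d γ = 1 := by
    have := hd γ
    rw [hΔ γ hγ] at this
    exact_mod_cast this.symm
  have hlt : ∀ ε : Rp, γ.1 ≠ α + ε := by
    intro ε h
    have := congrArg ht h
    rw [map_add, hd, hd, hd] at this
    have h3 : d γ = d α + d ε := by exact_mod_cast this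
    have := hpos α
    have := hpos ε
    omega
  rw [hef α γ hne] at h1
  rw [hef γ α hne.symm] at h2
  have hb0 : ∀ ε, b' α γ ε = 0 := fun ε => by
    by_contra h0
    exact hlt ε (hbs _ _ _ h0)
  have hc0 : ∀ ε, c' γ α ε = 0 := fun ε => by
    by_contra h0
    exact hlt ε (hcs _ _ _ h0)
  simp only [hb0, zero_smul, Finset.sum_const_zero, zero_add] at h1
  simp only [hc0, zero_smul, Finset.sum_const_zero, add_zero] at h2
  obtain ⟨δ, -, hδ⟩ := Finset.exists_ne_zero_of_sum_ne_zero h1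
  obtain ⟨δ', -, hδ'⟩ := Finset.exists_ne_zero_of_sum_ne_zero h2
  have hδ := left_ne_zero_of_smul hδ
  have hδ' := left_ne_zero_of_smul hδ'
  have e1 := hcs _ _ _ hδ
  have e2 := hbs _ _ _ hδ'
  have : δ = δ' := Subtype.ext (add_left_cancel (e1.symm.trans e2))
  subst this
  exact ⟨γ, δ, e1, hδ, hδ'⟩

end Positive

section HighestWeight

open TriangularDeformation

/-- If a module is the sum of subspaces consisting of weight vectors of distinct weights, then these
are the full weight spaces. -/
lemma mem_of_iSup_weight_eq_top {K V A J : Type*} [Field K] [AddCommGroup V] [Module K V]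
    {T : J → Module.End K V} (hT : ∀ i j, Commute (T i) (T j)) {W : A → Submodule K V}
    {ψ : A → J → K} (hψ : Function.Injective ψ) (hW : ∀ b, ∀ x ∈ W b, ∀ i, T i x = ψ b i • x)
    (htop : ⨆ b, W b = ⊤) {b : A} {x : V} (hx : ∀ i, T i x = ψ b i • x) : x ∈ W b := by
  have hind := Module.End.independent_iInf_maxGenEigenspace_of_forall_mapsTo T
    fun i j φ => Module.End.mapsTo_maxGenEigenspace_of_comm (hT j i) φ
  have hle : ∀ (b : A) (x : V), (∀ i, T i x = ψ b i • x) →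
      x ∈ ⨅ i, (T i).maxGenEigenspace (ψ b i) := by
    intro b x hx
    refine (Submodule.mem_iInf _).2 fun i => ?_
    refine (Module.End.mem_maxGenEigenspace _ _ _).2 ⟨1, ?_⟩
    simp [hx i]
  have hxt : x ∈ ⨆ b, W b := htop ▸ Submodule.mem_top
  rw [iSup_split_single _ b, Submodule.mem_sup] at hxt
  obtain ⟨y, hy, z, hz, rfl⟩ := hxt
  have hz1 : z ∈ ⨆ (χ) (_ : χ ≠ ψ b), ⨅ i, (T i).maxGenEigenspace (χ i) := by
    refine (show (⨆ (b') (_ : b' ≠ b), W b') ≤ _ from iSup₂_le fun b' hb' => ?_) hz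
    refine le_trans (fun w hw => hle b' w (hW b' w hw)) ?_
    exact le_iSup₂_of_le (ψ b') (fun h => hb' (hψ h)) le_rfl
  have hz2 : z ∈ ⨅ i, (T i).maxGenEigenspace (ψ b i) := by
    refine hle b z fun i => ?_
    have := hx i
    rw [map_add, hW b y hy, smul_add] at this
    exact add_left_cancel this
  have := Submodule.disjoint_def.1 (hind (ψ b)) z hz2 hz1
  rwa [this, add_zero]

variable {L : Type} [LieRing L] [LieAlgebra ℂ L]

/-- A vector generating a `U(g)`-module as a highest weight module. -/
structure IsHighestWeightVector (H : LieSubalgebra ℂ L) (Rp : Set (Module.Dual ℂ H))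
    (ν : Module.Dual ℂ H) {V : Type*} [AddCommGroup V] [Module (UniversalEnvelopingAlgebra ℂ L) V]
    (v : V) : Prop where
  root_smul : ∀ α ∈ Rp, ∀ x : L, IsRootVector H α x → ι ℂ x • v = 0
  cartan_smul : ∀ s : H, ι ℂ (s : L) • v = algebraMap ℂ (UniversalEnvelopingAlgebra ℂ L) (ν s) • v
  generates : ∀ m : V, ∃ u : UniversalEnvelopingAlgebra ℂ L, u • v = m

lemma isHighestWeightVector_mk (H : LieSubalgebra ℂ L) (Rp : Set (Module.Dual ℂ H))
    (ν : Module.Dual ℂ H) :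
    IsHighestWeightVector H Rp ν
      (Submodule.Quotient.mk 1 : VermaModule H Rp ν) where
  root_smul α hα x hx := by
    rw [← Submodule.Quotient.mk_smul, smul_eq_mul, mul_one, Submodule.Quotient.mk_eq_zero]
    exact Ideal.subset_span (Or.inl ⟨α, hα, x, hx, rfl⟩)
  cartan_smul s := by
    rw [← Submodule.Quotient.mk_smul, ← Submodule.Quotient.mk_smul, ← sub_eq_zero,
      ← Submodule.Quotient.mk_sub, smul_eq_mul, mul_one, smul_eq_mul, mul_one,
      Submodule.Quotient.mk_eq_zero]
    exact Ideal.subset_span (Or.inr ⟨s, rfl⟩)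
  generates m := by
    obtain ⟨u, rfl⟩ := Submodule.Quotient.mk_surjective _ m
    exact ⟨u, by rw [← Submodule.Quotient.mk_smul, smul_eq_mul, mul_one]⟩

variable {H : LieSubalgebra ℂ L} {R Rp : Set (Module.Dual ℂ H)} [Fintype Rp]
  {Δ : Finset (Module.Dual ℂ H)} {e f : Module.Dual ℂ H → L}

/-- The structure constants over the polynomial ring in the deformation parameter and the values of
the highest weight on the coroots. -/
noncomputable def StructureConstants.constants (sc : StructureConstants Rp Δ e f)
    (hcoroot : Module.Dual ℂ H → H) : Constants Rp (MvPolynomial (Option Rp) ℂ) where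
  s := MvPolynomial.X none
  h α := MvPolynomial.X (some α)
  k α γ := -(MvPolynomial.X none * MvPolynomial.C (γ.1 (hcoroot α)))
  a α γ ε := MvPolynomial.C (sc.a α γ ε)
  b α γ ε := MvPolynomial.C (sc.b α γ ε)
  c α γ ε := MvPolynomial.C (sc.c α γ ε)
  g α γ ε := MvPolynomial.C (sc.g α γ ε)

/-- Evaluation of the parameters at a highest weight and a value of the deformation parameter. -/
noncomputable def specialization (hcoroot : Module.Dual ℂ H → H) (p : Module.Dual ℂ H × ℂ) :
    MvPolynomial (Option Rp) ℂ →ₐ[ℂ] ℂ :=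
  MvPolynomial.aeval fun o => o.elim p.2 fun α => p.2 ^ 2 * p.1 (hcoroot α)

variable {V : Type*} [AddCommGroup V] [Module ℂ V] [Module (UniversalEnvelopingAlgebra ℂ L) V]
  [IsScalarTower ℂ (UniversalEnvelopingAlgebra ℂ L) V] {hcoroot : Module.Dual ℂ H → H}

local notation "ρ" => Algebra.lsmul ℂ ℂ V

lemma lsmul_ι_mul (x y : L) : (ρ (ι ℂ x) * ρ (ι ℂ y) : Module.End ℂ V) =
    ρ (ι ℂ y) * ρ (ι ℂ x) + ρ (ι ℂ ⁅x, y⁆) := by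
  have h : ι ℂ ⁅x, y⁆ = ι ℂ x * ι ℂ y - ι ℂ y * ι ℂ x := by
    let : LieRing (UniversalEnvelopingAlgebra ℂ L) := LieRing.ofAssociativeRing
    exact LieHom.map_lie (ι ℂ) x y
  rw [h, map_sub, map_mul, map_mul]
  abel

/-- The operators by which rescaled root vectors act on a highest weight module. -/
noncomputable def PositiveSystem.system (P : PositiveSystem H R Rp Δ e f hcoroot)
    (sc : StructureConstants Rp Δ e f) (p : Module.Dual ℂ H × ℂ) {v : V}
    (hv : IsHighestWeightVector H Rp p.1 v) :
    System ((sc.constants hcoroot).map (specialization hcoroot p)) V where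
  E α := p.2 • ρ (ι ℂ (e α))
  F α := p.2 • ρ (ι ℂ (f α))
  H α := p.2 ^ 2 • ρ (ι ℂ (hcoroot α : L))
  v := v
  E_v α := by
    simp [-ι_apply, hv.root_smul α α.2 _ (P.e_root α (P.pos_sub α.2)).1]
  H_v α := by
    simp [-ι_apply, hv.cartan_smul, Constants.map, StructureConstants.constants, specialization, mul_smul]
  EF_self α := by
    simp only [smul_mul_smul_comm, lsmul_ι_mul (e α), P.lie_e_f α (P.pos_sub α.2), smul_add, sq]
  HF α γ := by
    have h := (P.f_root γ (P.pos_sub γ.2)).1 (hcoroot α)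
    simp only [smul_mul_smul_comm, lsmul_ι_mul (hcoroot α : L), h, smul_add,
      Constants.map, StructureConstants.constants, specialization, map_smul]
    simp only [smul_smul, MvPolynomial.aeval_X, MvPolynomial.aeval_C, map_neg, map_mul,
      Option.elim, LinearMap.neg_apply, Algebra.algebraMap_self, RingHom.id_apply]
    congr 1
    · rw [mul_comm p.2]
    · congr 1; ring
  EF α γ hαγ := by
    simp only [smul_mul_smul_comm, lsmul_ι_mul (e α), sc.ef α γ hαγ, smul_add,
      Constants.map, StructureConstants.constants, specialization, map_smul, map_add, map_sum,
      Finset.smul_sum, smul_smul, MvPolynomial.aeval_X, MvPolynomial.aeval_C, Option.elim,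
      Algebra.algebraMap_self, RingHom.id_apply, mul_assoc, mul_comm (p.2)]
  FF α γ := by
    simp only [smul_mul_smul_comm, lsmul_ι_mul (f α), sc.ff α γ, smul_add,
      Constants.map, StructureConstants.constants, specialization, map_smul, map_sum,
      Finset.smul_sum, smul_smul, MvPolynomial.aeval_X, MvPolynomial.aeval_C, Option.elim,
      Algebra.algebraMap_self, RingHom.id_apply, mul_assoc, mul_comm (p.2)]
  EE α γ := by
    simp only [smul_mul_smul_comm, lsmul_ι_mul (e α), sc.ee α γ, smul_add,
      Constants.map, StructureConstants.constants, specialization, map_smul, map_sum,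
      Finset.smul_sum, smul_smul, MvPolynomial.aeval_X, MvPolynomial.aeval_C, Option.elim,
      Algebra.algebraMap_self, RingHom.id_apply, mul_assoc, mul_comm (p.2)]

lemma StructureConstants.isGraded (sc : StructureConstants Rp Δ e f)
    (hcoroot : Module.Dual ℂ H → H) :
    (sc.constants hcoroot).IsGraded (Subtype.val : Rp → Module.Dual ℂ H) where
  a_supp α γ ε h := sc.a_supp α γ ε fun h0 => h (by simp [constants, h0])
  b_supp α γ ε h := sc.b_supp α γ ε fun h0 => h (by simp [constants, h0])
  c_supp α γ ε h := sc.c_supp α γ ε fun h0 => h (by simp [constants, h0])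
  g_supp α γ ε h := sc.g_supp α γ ε fun h0 => h (by simp [constants, h0])

lemma ι_smul_ι_smul (x y : L) (m : V) :
    ι ℂ x • ι ℂ y • m = ι ℂ y • ι ℂ x • m + ι ℂ ⁅x, y⁆ • m :=
  LinearMap.congr_fun (lsmul_ι_mul x y) m

/-- A subspace stable under a Lie algebra is stable under its universal enveloping algebra. -/
lemma smul_mem_of_ι_smul_mem (W : Submodule ℂ V) (h : ∀ x : L, ∀ w ∈ W, ι ℂ x • w ∈ W)
    (u : UniversalEnvelopingAlgebra ℂ L) : ∀ w ∈ W, u • w ∈ W := by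
  obtain ⟨a, rfl⟩ : ∃ a, mkAlgHom ℂ L a = u := RingCon.mkₐ_surjective _ u
  induction a using TensorAlgebra.induction with
  | algebraMap r =>
    intro w hw
    rw [AlgHom.commutes, algebraMap_smul]
    exact W.smul_mem _ hw
  | ι x =>
    intro w hw
    rw [← ι_apply]
    exact h x w hw
  | mul a b ha hb =>
    intro w hw
    rw [map_mul, mul_smul]
    exact ha _ (hb _ hw)
  | add a b ha hb =>
    intro w hw
    rw [map_add, add_smul]
    exact W.add_mem (ha _ hw) (hb _ hw)

section System

variable (P : PositiveSystem H R Rp Δ e f hcoroot) (sc : StructureConstants Rp Δ e f)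
  {p : Module.Dual ℂ H × ℂ} {v : V} (hv : IsHighestWeightVector H Rp p.1 v)

namespace PositiveSystem

lemma system_F_apply (α : Rp) (m : V) : (P.system sc p hv).F α m = p.2 • ι ℂ (f α) • m := rfl

lemma cartan_smul_word (t : H) (w : List Rp) : ι ℂ (t : L) • (P.system sc p hv).word w =
    (p.1 t - mwt Subtype.val (w : Multiset Rp) t) • (P.system sc p hv).word w := by
  induction w with
  | nil =>
    rw [System.word_nil, Multiset.coe_nil, mwt_zero, LinearMap.zero_apply, sub_zero]
    exact (hv.cartan_smul t).trans (algebraMap_smul _ _ _)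
  | cons γ w ih =>
    rw [System.word_cons, system_F_apply, smul_comm _ p.2, ι_smul_ι_smul, ih,
      (P.f_root γ (P.pos_sub γ.2)).1 t, ← Multiset.cons_coe, mwt_cons, map_smul, smul_assoc,
      smul_comm (ι ℂ (f γ)) (_ : ℂ)]
    simp only [LinearMap.add_apply, LinearMap.neg_apply]
    generalize ι ℂ (f γ) • (P.system sc p hv).word w = z
    module

lemma cartan_smul_of_mem_L {b : Module.Dual ℂ H} {x : V}
    (hx : x ∈ (P.system sc p hv).L Subtype.val b) (t : H) :
    ι ℂ (t : L) • x = (p.1 t - b t) • x := by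
  induction hx using Submodule.span_induction with
  | mem x h =>
    obtain ⟨m, rfl, rfl⟩ := h
    refine (P.cartan_smul_word sc hv t m.toList).trans ?_
    rw [Multiset.coe_toList]
    rfl
  | zero => simp
  | add x y _ _ hx hy => rw [smul_add, hx, hy, smul_add]
  | smul r x _ hx => rw [smul_comm, hx, smul_comm]

variable [FiniteDimensional ℂ L] [H.IsCartanSubalgebra] [LieAlgebra.IsSemisimple ℂ L]

lemma iSup_L_eq_top (hp : p.2 ≠ 0) : ⨆ b, (P.system sc p hv).L Subtype.val b = ⊤ := by
  classical
  have hC : ((sc.constants hcoroot).map (specialization hcoroot p)).IsGraded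
      (Subtype.val : Rp → Module.Dual ℂ H) :=
    have h := sc.isGraded hcoroot
    ⟨fun α γ ε h0 => h.a_supp α γ ε fun h1 => h0 (by simp [Constants.map, h1]),
      fun α γ ε h0 => h.b_supp α γ ε fun h1 => h0 (by simp [Constants.map, h1]),
      fun α γ ε h0 => h.c_supp α γ ε fun h1 => h0 (by simp [Constants.map, h1]),
      fun α γ ε h0 => h.g_supp α γ ε fun h1 => h0 (by simp [Constants.map, h1])⟩
  set W := ⨆ b, (P.system sc p hv).L Subtype.val b with hW
  have key : ∀ T : Module.End ℂ V, (∀ b, ∀ x ∈ (P.system sc p hv).L Subtype.val b, T x ∈ W) →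
      ∀ x ∈ W, T x ∈ W := by
    intro T hT x hx
    have : W ≤ W.comap T := iSup_le hT
    exact this hx
  have hle : ∀ b, (P.system sc p hv).L Subtype.val b ≤ W := fun b => le_iSup _ b
  have hE : ∀ α : Rp, ∀ x ∈ W, ι ℂ (e α) • x ∈ W := fun α x hx =>
    (W.smul_mem_iff hp).1 (key ((P.system sc p hv).E α)
      (fun b x hx => hle _ ((System.hasSymbol_E hC α).map_L hx)) x hx)
  have hF : ∀ α : Rp, ∀ x ∈ W, ι ℂ (f α) • x ∈ W := fun α x hx =>
    (W.smul_mem_iff hp).1 (key ((P.system sc p hv).F α)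
      (fun b x hx => hle _ ((System.hasSymbol_F hC α).map_L hx)) x hx)
  have hT : ∀ t : H, ∀ x ∈ W, ι ℂ (t : L) • x ∈ W := fun t =>
    key (Algebra.lsmul ℂ ℂ V (ι ℂ (t : L))) fun b x hx => by
      rw [Algebra.lsmul_coe]
      change ι ℂ (t : L) • x ∈ W
      rw [P.cartan_smul_of_mem_L sc hv hx]
      exact W.smul_mem _ (hle b hx)
  let U : Submodule ℂ L :=
    { carrier := {x | ∀ w ∈ W, ι ℂ x • w ∈ W}
      add_mem' := fun {x y} hx hy w hw => by
        rw [map_add, add_smul]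
        exact W.add_mem (hx w hw) (hy w hw)
      zero_mem' := fun w _ => by
        rw [map_zero, zero_smul]
        exact W.zero_mem
      smul_mem' := fun r x hx w hw => by
        rw [map_smul, smul_assoc]
        exact W.smul_mem _ (hx w hw) }
  have hU : U = ⊤ := eq_top_of_rootVectors_mem U hT fun θ hθ x hx => by
    obtain ⟨b, c, rfl, -, -⟩ := P.exists_eq_sum hθ hx
    exact U.add_mem (U.sum_mem fun ε _ => U.smul_mem _ (hF ε))
      (U.sum_mem fun ε _ => U.smul_mem _ (hE ε))
  have hall := smul_mem_of_ι_smul_mem W fun x => (hU ▸ Submodule.mem_top : x ∈ U)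
  have hvW : v ∈ W := by
    have : (P.system sc p hv).word [] ∈ (P.system sc p hv).L Subtype.val _ :=
      System.word_mem _ hC []
    rw [System.word_nil] at this
    exact hle _ this
  refine eq_top_iff.2 fun m _ => ?_
  obtain ⟨u, rfl⟩ := hv.generates m
  exact hall u v hvW

/-- The weight spaces of a highest weight module are spanned by monomials. -/
lemma mem_L_of_cartan_smul (hp : p.2 ≠ 0) {b : Module.Dual ℂ H} {x : V}
    (hx : ∀ t : H, ι ℂ (t : L) • x = (p.1 t - b t) • x) :
    x ∈ (P.system sc p hv).L Subtype.val b := by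
  refine mem_of_iSup_weight_eq_top (T := fun t : H => Algebra.lsmul ℂ ℂ V (ι ℂ (t : L)))
    (W := fun b => (P.system sc p hv).L Subtype.val b) (ψ := fun b t => p.1 t - b t) (fun s t => ?_) (fun b b' h => ?_)
    (fun b x hx t => P.cartan_smul_of_mem_L sc hv hx t) (P.iSup_L_eq_top sc hv hp) hx
  · have := lsmul_ι_mul (V := V) (s : L) t
    rw [lie_cartan, map_zero, map_zero, add_zero] at this
    exact this
  · exact LinearMap.ext fun t => sub_right_injective (congrFun h t)

end PositiveSystem

end System

end HighestWeight

section Generic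

open TriangularDeformation

variable {L : Type} [LieRing L] [LieAlgebra ℂ L] {H : LieSubalgebra ℂ L}
  {R Rp : Set (Module.Dual ℂ H)} [Fintype Rp] {Δ : Finset (Module.Dual ℂ H)}
  {e f : Module.Dual ℂ H → L} {hcoroot : Module.Dual ℂ H → H}

/-- The point of parameter space with vanishing deformation parameter at which the Heisenberg
constants are the values of `μ` on the coroots. -/
noncomputable def degeneration (hcoroot : Module.Dual ℂ H → H) (μ : Module.Dual ℂ H) :
    MvPolynomial (Option Rp) ℂ →ₐ[ℂ] ℂ :=
  MvPolynomial.aeval fun o => o.elim 0 fun α => μ (hcoroot α)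

namespace PositiveSystem

variable (P : PositiveSystem H R Rp Δ e f hcoroot)

include P

omit [Fintype Rp] in
lemma exists_dual_coroot_ne_zero [FiniteDimensional ℂ L] [H.IsCartanSubalgebra] [Finite Rp] :
    ∃ μ : Module.Dual ℂ H, ∀ α : Rp, μ (hcoroot α) ≠ 0 := by
  refine Module.exists_dual_forall_apply_ne_zero (fun α : Rp => hcoroot α) fun α h => ?_
  have := P.apply_coroot α (P.pos_sub α.2)
  rw [h, map_zero] at this
  norm_num at this

lemma isAdmissible [FiniteDimensional ℂ L] [H.IsCartanSubalgebra] [LieAlgebra.IsSemisimple ℂ L]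
    (sc : StructureConstants Rp Δ e f) {μ : Module.Dual ℂ H} (hμ : ∀ α : Rp, μ (hcoroot α) ≠ 0) :
    ∃ (ht : Module.Dual ℂ H →+ ℂ) (d : Rp → ℕ),
      System.IsAdmissible (sc.constants hcoroot) (Subtype.val : Rp → Module.Dual ℂ H)
        ((degeneration hcoroot μ : MvPolynomial (Option Rp) ℂ →ₐ[ℂ] ℂ) :
          MvPolynomial (Option Rp) ℂ →+* ℂ) ht d {α | α.1 ∈ Δ} := by
  obtain ⟨ht, d, -, hd, hpos⟩ := P.exists_height
  exact ⟨ht.toAddMonoidHom, d,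
    { graded := sc.isGraded hcoroot
      χ_s := by simp [degeneration, StructureConstants.constants]
      χ_h := fun α => by simpa [degeneration, StructureConstants.constants] using hμ α
      ht_wt := hd
      d_pos := hpos
      unique := P.eq_of_sum_eq
      split := fun α hα => by
        obtain ⟨γ, δ, h, h1, h2⟩ := sc.split α hα
        refine ⟨γ, δ, h, ?_, ?_⟩ <;>
          simpa [degeneration, StructureConstants.constants] }⟩

end PositiveSystem

omit [Fintype Rp] in
/-- A polynomial which does not vanish at the degeneration does not vanish identically on some slice
with invertible deformation parameter. -/
lemma exists_polynomial_function {hcoroot : Module.Dual ℂ H → H} {μ : Module.Dual ℂ H}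
    {Q : MvPolynomial (Option Rp) ℂ} (hQ : degeneration hcoroot μ Q ≠ 0) : ∃ s : ℂ, s ≠ 0 ∧
    (fun ν => specialization hcoroot (ν, s) Q) ∈
      Algebra.adjoin ℂ {g : Module.Dual ℂ H → ℂ | ∃ t : H, g = fun ν => ν t} ∧
    (fun ν => specialization hcoroot (ν, s) Q) ≠ 0 := by
  let φ : MvPolynomial (Option Rp) ℂ →ₐ[ℂ] Polynomial ℂ :=
    MvPolynomial.aeval fun o => o.elim Polynomial.X fun α => Polynomial.C (μ (hcoroot α))
  have hφ : ∀ s, (Polynomial.aeval s).comp φ =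
      MvPolynomial.aeval fun o => o.elim s fun α : Rp => μ (hcoroot α) := by
    intro s
    ext o
    cases o <;> simp [φ]
  have hφ0 : φ Q ≠ 0 := by
    intro h
    refine hQ ?_
    have := AlgHom.congr_fun (hφ 0) Q
    rw [AlgHom.comp_apply, h, map_zero] at this
    exact this.symm
  obtain ⟨s, hs⟩ : ∃ s, (Polynomial.X * φ Q).eval s ≠ 0 := by
    by_contra! h
    exact mul_ne_zero Polynomial.X_ne_zero hφ0 (Polynomial.funext fun s => by
      rw [h, Polynomial.eval_zero])
  rw [Polynomial.eval_mul, Polynomial.eval_X] at hs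
  have hs0 := left_ne_zero_of_mul hs
  refine ⟨s, hs0, ?_, fun h => right_ne_zero_of_mul hs ?_⟩
  · let ψ : MvPolynomial (Option Rp) ℂ →ₐ[ℂ] (Module.Dual ℂ H → ℂ) :=
      MvPolynomial.aeval fun o => o.elim (algebraMap ℂ _ s) fun α => s ^ 2 • fun ν => ν (hcoroot α)
    have hψ : ψ Q = fun ν => specialization hcoroot (ν, s) Q := by
      funext ν
      have : (Pi.evalAlgHom ℂ (fun _ : Module.Dual ℂ H => ℂ) ν).comp ψ =
          specialization hcoroot (ν, s) := by
        ext o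
        cases o <;> simp [ψ, specialization]
      exact AlgHom.congr_fun this Q
    rw [← hψ]
    have hr : ψ Q ∈ ψ.range := ⟨Q, rfl⟩
    rw [← Algebra.adjoin_range_eq_range_aeval] at hr
    refine Algebra.adjoin_le ?_ hr
    rintro _ ⟨_ | α, rfl⟩
    · exact Subalgebra.algebraMap_mem _ s
    · exact Subalgebra.smul_mem _ (Algebra.subset_adjoin (Set.mem_ofPred.2 ⟨hcoroot α, rfl⟩)) _
  · have h1 := congrFun h ((s ^ 2)⁻¹ • μ)
    have h2 := AlgHom.congr_fun (hφ s) Q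
    rw [AlgHom.comp_apply, Polynomial.coe_aeval_eq_eval] at h2
    refine (h2.trans ?_).trans h1
    simp [specialization, hs0]

theorem PositiveSystem.exists_generic [FiniteDimensional ℂ L] [H.IsCartanSubalgebra]
    [LieAlgebra.IsSemisimple ℂ L] (P : PositiveSystem H R Rp Δ e f hcoroot)
    (β : Module.Dual ℂ H) :
    ∃ Q : Module.Dual ℂ H → ℂ,
      Q ∈ Algebra.adjoin ℂ {g : Module.Dual ℂ H → ℂ | ∃ s : H, g = fun ν => ν s} ∧
      Q ≠ 0 ∧
      ∀ μ : Module.Dual ℂ H, Q μ ≠ 0 → ∀ N : Submodule ℂ (VermaModule H Rp μ),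
        (∀ m ∈ N, ∀ s : H, (ι ℂ (s : L)) • m = (μ s - β s) • m) →
        (∀ α ∈ Rp, ∀ m ∈ N, ι ℂ (f α) • ι ℂ (e α) • m ∈ N) →
        N = ⊥ ∨ ∀ m : VermaModule H Rp μ,
          (∀ s : H, (ι ℂ (s : L)) • m = (μ s - β s) • m) → m ∈ N := by
  classical
  obtain ⟨sc⟩ := P.nonempty_structureConstants
  obtain ⟨μ₀, hμ₀⟩ := P.exists_dual_coroot_ne_zero
  obtain ⟨ht, d, hA⟩ := P.isAdmissible sc hμ₀
  have := hA.finite β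
  have := Fintype.ofFinite {m : Multiset Rp // mwt Subtype.val m = β}
  let S := fun p : Module.Dual ℂ H × ℂ =>
    P.system sc p (isHighestWeightVector_mk H Rp p.1)
  obtain ⟨Q, hQ, hgen⟩ := hA.exists_generic_family (specialization hcoroot) S β
  obtain ⟨s, hs, hQ1, hQ2⟩ := exists_polynomial_function hQ
  refine ⟨_, hQ1, hQ2, fun μ hμ N hN hκ => or_iff_not_imp_left.2 fun hne m hm => ?_⟩
  have hmem : ∀ m : VermaModule H Rp μ, (∀ t : H, (ι ℂ (t : L)) • m = (μ t - β t) • m) →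
      ∃ r : {m : Multiset Rp // mwt Subtype.val m = β} → ℂ, ∑ i, r i • (S (μ, s)).y i = m :=
    fun m hm => System.mem_L_iff.1
      (P.mem_L_of_cartan_smul sc (p := (μ, s)) (isHighestWeightVector_mk H Rp μ) hs hm)
  obtain ⟨x, hx, hx0⟩ := N.exists_mem_ne_zero_of_ne_bot hne
  obtain ⟨c, hc⟩ := hmem x (hN x hx)
  obtain ⟨j, -, hj⟩ := Finset.exists_ne_zero_of_sum_ne_zero (hc ▸ hx0)
  have hj := left_ne_zero_of_smul hj
  have hy : ∀ i : {m : Multiset Rp // mwt Subtype.val m = β}, (S (μ, s)).y i ∈ N := fun i => by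
    refine (N.smul_mem_iff (mul_ne_zero hμ hj)).1
      (hgen (μ, s) ?_ N (fun α x hx => ?_) c (hc ▸ hx) i j)
    · simpa [StructureConstants.constants, specialization] using hs
    · change s • ι ℂ (f α) • s • ι ℂ (e α) • x ∈ N
      rw [smul_comm _ s]
      exact N.smul_mem _ (N.smul_mem _ (hκ α α.2 x hx))
  obtain ⟨r, rfl⟩ := hmem m hm
  exact N.sum_mem fun i _ => N.smul_mem _ (hy i)

omit [Fintype Rp] in
/-- The invariant form does not vanish on the vector representing a root. -/
lemma killingForm_self_ne_zero {B : LinearMap.BilinForm ℂ L} {c : ℂ}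
    (hB : B = c • killingForm ℂ L) {α : Module.Dual ℂ H} {x y : L} {h t : H}
    (hy : IsRootVector H (-α) y) (hxy : ⁅x, y⁆ = (h : L)) (hα : α h = 2)
    (ht : ∀ s : H, B t s = α s) : B t t ≠ 0 := by
  have h1 : B h t = α t * B x y := by
    rw [← hxy, hB, LinearMap.smul_apply, LinearMap.smul_apply, LinearMap.smul_apply,
      LinearMap.smul_apply, LieModule.traceForm_apply_lie_apply, ← lie_skew, hy t]
    simp
    ring
  have h2 : B h t = B t h := by
    simp only [hB, LinearMap.smul_apply, LieModule.traceForm_comm ℂ L L (h : L)]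
  intro h0
  rw [ht] at h0
  rw [h2, ht, h0, hα, zero_mul] at h1
  norm_num at h1

end Generic

/-- Etingof: for every `β` in the `ℕ`-span of the simple roots there is a nonzero
polynomial function `P` on `h*` such that, whenever `P(μ) ≠ 0`, the weight space
`M_μ[μ − β]` of the Verma module `M_μ` is irreducible under the Casimir algebra `C(g)`. -/
theorem verma_weight_spaces_generically_casimir_irreducible
    {L : Type} [LieRing L] [LieAlgebra ℂ L] [FiniteDimensional ℂ L]
    [LieAlgebra.IsSemisimple ℂ L]
    (H : LieSubalgebra ℂ L) [H.IsCartanSubalgebra]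
    (c : ℂ) (hc : c ≠ 0)
    (B : LinearMap.BilinForm ℂ L) (hB : B = c • killingForm ℂ L)
    (R : Set (Module.Dual ℂ H))
    (hR : R = {α | α ≠ 0 ∧ ∃ x : L, x ≠ 0 ∧ IsRootVector H α x})
    -- a system of positive roots
    (Rp : Set (Module.Dual ℂ H)) (hRpR : Rp ⊆ R)
    (hRp1 : ∀ α ∈ R, α ∈ Rp ∨ -α ∈ Rp) (hRp2 : ∀ α ∈ Rp, -α ∉ Rp)
    (hRp3 : ∀ α ∈ Rp, ∀ β ∈ Rp, α + β ∈ R → α + β ∈ Rp)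
    -- the corresponding simple roots
    (Δ : Finset (Module.Dual ℂ H)) (hΔRp : (Δ : Set (Module.Dual ℂ H)) ⊆ Rp)
    (hΔind : LinearIndependent ℂ (Subtype.val : {x // x ∈ Δ} → Module.Dual ℂ H))
    (hΔbase : ∀ α ∈ Rp, ∃ k : Δ → ℕ, α = ∑ a : Δ, (k a : ℂ) • (a : Module.Dual ℂ H))
    (t : Module.Dual ℂ H → H)
    (ht : ∀ α ∈ R, ∀ x : H, B (t α) x = α x)
    (e f : Module.Dual ℂ H → L) (hcoroot : Module.Dual ℂ H → H)
    (he : ∀ α ∈ R, IsRootVector H α (e α) ∧ e α ≠ 0)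
    (hf : ∀ α ∈ R, IsRootVector H (-α) (f α) ∧ f α ≠ 0)
    (hef : ∀ α ∈ R, ⁅e α, f α⁆ = (hcoroot α : L))
    (hcoroot2 : ∀ α ∈ R, α (hcoroot α) = 2)
    (κ : Module.Dual ℂ H → UniversalEnvelopingAlgebra ℂ L)
    (hκ : ∀ α ∈ R, κ α = (B (t α) (t α) / 2) •
      (ι ℂ (e α) * ι ℂ (f α) + ι ℂ (f α) * ι ℂ (e α)))
    -- `β` is a non-negative integral combination of the simple roots
    (kcoef : Δ → ℕ) (β : Module.Dual ℂ H)
    (hβ : β = ∑ a : Δ, (kcoef a : ℂ) • (a : Module.Dual ℂ H)) :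
    ∃ P : Module.Dual ℂ H → ℂ,
      P ∈ Algebra.adjoin ℂ {g : Module.Dual ℂ H → ℂ | ∃ s : H, g = fun ν => ν s} ∧
      P ≠ 0 ∧
      ∀ μ : Module.Dual ℂ H, P μ ≠ 0 →
        ∀ N : Submodule ℂ (VermaModule H Rp μ),
          -- `N` is contained in the weight space `M_μ[μ − β]`
          (∀ m ∈ N, ∀ s : H, (ι ℂ (s : L)) • m = (μ s - β s) • m) →
          -- `N` is invariant under `h` and under all truncated Casimirs
          (∀ s : H, ∀ m ∈ N, (ι ℂ (s : L)) • m ∈ N) →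
          (∀ α ∈ R, ∀ m ∈ N, κ α • m ∈ N) →
          N = ⊥ ∨ ∀ m : VermaModule H Rp μ,
            (∀ s : H, (ι ℂ (s : L)) • m = (μ s - β s) • m) → m ∈ N := by
  have P : PositiveSystem H R Rp Δ e f hcoroot :=
    { mem_iff := fun α => by rw [hR]; rfl
      pos_sub := hRpR
      pos_or_neg := hRp1
      simple_sub := hΔRp
      linearIndependent := hΔind
      exists_sum := hΔbase
      e_root := he
      f_root := hf
      lie_e_f := hef
      apply_coroot := hcoroot2 }
  have := (finite_roots Rp fun α hα => ((P.mem_iff α).1 (hRpR hα)).2).fintype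
  obtain ⟨Q, hQ, hQ0, h⟩ := P.exists_generic β
  refine ⟨Q, hQ, hQ0, fun μ hμ N hN hH hκN => h μ hμ N hN fun α hα m hm => ?_⟩
  have hαR := hRpR hα
  have hB0 := killingForm_self_ne_zero hB (hf α hαR).1 (hef α hαR) (hcoroot2 α hαR) (ht α hαR)
  have h1 := hκN α hαR m hm
  rw [hκ α hαR, smul_assoc, N.smul_mem_iff (div_ne_zero hB0 two_ne_zero), add_smul, mul_smul,
    mul_smul, ι_smul_ι_smul, hef α hαR] at h1
  have h2 := N.sub_mem h1 (hH (hcoroot α) m hm)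
  rw [add_right_comm, add_sub_cancel_right, ← two_smul ℂ] at h2
  exact (N.smul_mem_iff two_ne_zero).1 h2
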